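/- Let m ≥ 1 be an integer and let f: ℝ → ℝ be even and continuous with |f(x)| ≤ A(1+|x|)^{−1−ε} and with Fourier transform f̂ continuous satisfying |f̂(u)| ≤ A(1+|u|)^{−1−ε} for some A, ε > 0. For each N ≥ 1 define Z_f(U) := Σ_{n∈ℤ} (1/N) f̂(n/N) Tr(U^n) on U(N). Then lim_{N→∞} ∫_{U(N)} Z_f(U)^m dμ_N(U) = Σ_{r=1}^{m} Σ_{σ ∈ P(m,r)} ∫_{ℝ^r} R_r(x_1, …, x_r) ∏_{k=1}^{r} f(x_k)^{λ_k} dx_1 ⋯ dx_r, where λ_k = #{j : σ(j) = k}, and R_r(x_1, …, x_r) = det( K(x_i, x_j) )_{1 ≤ i,j ≤ r} with K(x, y) = sin(π(x−y))/(π(x−y)) for x ≠ y and K(x, x) = 1. -/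

import Mathlib

open MeasureTheory Filter

noncomputable instance (N : ℕ) : MeasurableSpace (Matrix.unitaryGroup (Fin N) ℂ) := borel _

/-- The linear statistic `Z_f(U) = ∑_{n ∈ ℤ} (1/N) f̂(n/N) Tr(U^n)` on `U(N)`. -/
noncomputable def Zf (N : ℕ) (fhat : ℝ → ℝ) (U : Matrix.unitaryGroup (Fin N) ℂ) : ℂ :=
  ∑' n : ℤ, (1 / N : ℂ) * (fhat ((n : ℝ) / N) : ℂ) *
    Matrix.trace ((U ^ n : Matrix.unitaryGroup (Fin N) ℂ) : Matrix (Fin N) (Fin N) ℂ)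

/-- The sine kernel `K(x,y) = sin(π(x-y))/(π(x-y))`, with `K(x,x) = 1`. -/
noncomputable def sineKernel (x y : ℝ) : ℝ :=
  if x = y then 1 else Real.sin (Real.pi * (x - y)) / (Real.pi * (x - y))

/-- The `r`-point correlation function `R_r(x₁,…,x_r) = det(K(x_i,x_j))`. -/
noncomputable def sineCorrelation (r : ℕ) (x : Fin r → ℝ) : ℝ :=
  Matrix.det (Matrix.of fun i j : Fin r => sineKernel (x i) (x j))

/-- The algebra of real Laurent polynomials in `N` variables. -/
abbrev LaurentAlg (N : ℕ) := AddMonoidAlgebra ℝ (Fin N → ℤ)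

namespace LaurentAlg

variable {N : ℕ}

/-- The monomial `z_j ^ n`. -/
noncomputable def X (j : Fin N) (n : ℤ) : LaurentAlg N := AddMonoidAlgebra.single (Pi.single j n) 1

lemma X_mul (j : Fin N) (m n : ℤ) : X j m * X j n = X j (m + n) := by
  simp [X, AddMonoidAlgebra.single_mul_single, Pi.single_add]

lemma X_zero (j : Fin N) : X j 0 = 1 := by
  simp [X, AddMonoidAlgebra.one_def]

lemma X_pow (j : Fin N) (m : ℤ) (k : ℕ) : X j m ^ k = X j (k * m) := by
  induction k with
  | zero => simp [X_zero]
  | succ k ih => rw [pow_succ, ih, X_mul]; congr 1; push_cast; ring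

/-- The power sum `∑ z_j ^ n`. -/
noncomputable def psum (n : ℤ) : LaurentAlg N := ∑ j, X j n

/-- The Euler derivation `z_j ∂/∂z_j`, as a linear map. -/
noncomputable def eulerLin (j : Fin N) : LaurentAlg N →ₗ[ℝ] LaurentAlg N :=
  (Finsupp.lsum ℝ fun e : Fin N → ℤ => (e j : ℝ) • AddMonoidAlgebra.lsingle (R := ℝ) e) ∘ₗ
    (AddMonoidAlgebra.coeffLinearEquiv ℝ).toLinearMap

lemma eulerLin_single (j : Fin N) (e : Fin N → ℤ) (r : ℝ) :
    eulerLin j (AddMonoidAlgebra.single e r) = (e j : ℝ) • AddMonoidAlgebra.single e r := by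
  simp [eulerLin]

/-- The Euler derivation `z_j ∂/∂z_j`. -/
noncomputable def euler (j : Fin N) : Derivation ℝ (LaurentAlg N) (LaurentAlg N) :=
  Derivation.mk' (eulerLin j) <| by
    intro a b
    induction a using AddMonoidAlgebra.induction_linear with
    | zero => simp
    | add a a' h h' => simp only [add_mul, map_add, h, h', smul_eq_mul, mul_add]; ring
    | single e r =>
      induction b using AddMonoidAlgebra.induction_linear with
      | zero => simp
      | add b b' h h' => simp only [mul_add, map_add, h, h', smul_eq_mul, add_mul]; ring
      | single e' r' =>
        simp [AddMonoidAlgebra.single_mul_single, eulerLin_single, ← AddMonoidAlgebra.single_add,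
          add_comm e' e]
        ring_nf

lemma euler_single (j : Fin N) (e : Fin N → ℤ) (r : ℝ) :
    euler j (AddMonoidAlgebra.single e r) = (e j : ℝ) • AddMonoidAlgebra.single e r :=
  eulerLin_single j e r

lemma euler_coeff (j : Fin N) (F : LaurentAlg N) (e : Fin N → ℤ) :
    (euler j F).coeff e = e j * F.coeff e := by
  induction F using AddMonoidAlgebra.induction_linear with
  | zero => simp
  | add a b h h' => simp [h, h', mul_add]
  | single e' r =>
    simp only [euler_single, AddMonoidAlgebra.coeff_smul_apply,
      AddMonoidAlgebra.coeff_single, Finsupp.single_apply]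
    split_ifs with h <;> simp [h]

lemma euler_X (i j : Fin N) (n : ℤ) : euler i (X j n) = if i = j then (n : ℝ) • X j n else 0 := by
  rw [X, euler_single]
  split_ifs with h
  · simp [h]
  · simp [h]

/-- The inversion `z_j ↦ z_j⁻¹`. -/
noncomputable def inv : LaurentAlg N ≃ₐ[ℝ] LaurentAlg N :=
  AddMonoidAlgebra.domCongr ℝ ℝ (AddEquiv.neg (Fin N → ℤ))

lemma inv_single (e : Fin N → ℤ) (r : ℝ) :
    inv (AddMonoidAlgebra.single e r) = AddMonoidAlgebra.single (-e) r := by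
  simp [inv]

lemma inv_coeff (F : LaurentAlg N) (e : Fin N → ℤ) : (inv F).coeff e = F.coeff (-e) := by
  simp [inv, AddMonoidAlgebra.coeff_domCongr]

lemma inv_X (j : Fin N) (n : ℤ) : inv (X j n) = X j (-n) := by
  simp [X, inv_single, Pi.single_neg]

lemma inv_psum (n : ℤ) : inv (psum n : LaurentAlg N) = psum (-n) := by
  simp [psum, inv_X]

lemma inv_inv (F : LaurentAlg N) : inv (inv F) = F := by
  ext e; simp [inv_coeff]

lemma euler_inv (j : Fin N) (F : LaurentAlg N) : euler j (inv F) = - inv (euler j F) := by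
  ext e; simp [inv_coeff, euler_coeff]

/-- The constant term. -/
noncomputable def CT : LaurentAlg N →ₗ[ℝ] ℝ :=
  (Finsupp.lapply 0) ∘ₗ (AddMonoidAlgebra.coeffLinearEquiv ℝ).toLinearMap

lemma CT_apply (F : LaurentAlg N) : CT F = F.coeff 0 := by simp [CT]

lemma CT_single (e : Fin N → ℤ) (r : ℝ) : CT (AddMonoidAlgebra.single e r) = if e = 0 then r else 0 := by
  rw [CT_apply, AddMonoidAlgebra.coeff_single, Finsupp.single_apply]

lemma CT_euler (j : Fin N) (F : LaurentAlg N) : CT (euler j F) = 0 := by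
  simp [CT_apply, euler_coeff]

lemma CT_mul_inv (F : LaurentAlg N) : CT (F * inv F) = ∑ e ∈ F.coeff.support, F.coeff e ^ 2 := by
  rw [CT_apply, AddMonoidAlgebra.coeff_mul_apply_left, Finsupp.sum]
  refine Finset.sum_congr rfl fun e _ => ?_
  simp [inv_coeff, sq]

lemma CT_mul_inv_nonneg (F : LaurentAlg N) : 0 ≤ CT (F * inv F) := by
  rw [CT_mul_inv]; positivity

lemma eq_zero_of_CT_mul_inv (F : LaurentAlg N) (h : CT (F * inv F) = 0) : F = 0 := by
  rw [CT_mul_inv, Finset.sum_eq_zero_iff_of_nonneg (fun _ _ => sq_nonneg _)] at h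
  ext e
  by_contra he
  exact he (by simpa using h e (by simpa using he))

lemma eq_const_of_euler (F : LaurentAlg N) (h : ∀ j, euler j F = 0) :
    F = (F.coeff 0) • (1 : LaurentAlg N) := by
  ext e
  by_cases he : e = 0
  · simp [he, AddMonoidAlgebra.one_def]
  · obtain ⟨j, hj⟩ := Function.ne_iff.mp he
    have := congrArg (fun G => G.coeff e) (h j)
    simp only [euler_coeff, AddMonoidAlgebra.coeff_zero, Finsupp.coe_zero, Pi.zero_apply,
      mul_eq_zero] at this
    rcases this with h1 | h1
    · exact absurd (by exact_mod_cast h1) hj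
    · simp [h1, AddMonoidAlgebra.one_def, Ne.symm he]

end LaurentAlg

namespace LaurentAlg

variable {N : ℕ}

/-- The vector field `∑ z_j ^ (n + 1) ∂/∂z_j`. -/
noncomputable def wittD (n : ℤ) : Derivation ℝ (LaurentAlg N) (LaurentAlg N) :=
  ∑ j, X j n • euler j

lemma wittD_apply (n : ℤ) (F : LaurentAlg N) : wittD n F = ∑ j, X j n * euler j F := by
  simp only [wittD, ← Derivation.coeFnAddMonoidHom_apply, map_sum, Finset.sum_apply]
  rfl

lemma wittD_X (n : ℤ) (j : Fin N) (m : ℤ) : wittD n (X j m) = (m : ℝ) • X j (n + m) := by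
  simp [wittD_apply, euler_X, X_mul]

lemma wittD_psum (n m : ℤ) : wittD n (psum m : LaurentAlg N) = (m : ℝ) • psum (n + m) := by
  simp only [psum, map_sum, wittD_X, Finset.smul_sum]

/-- The Vandermonde determinant. -/
noncomputable def vand (N : ℕ) : LaurentAlg N := (Matrix.vandermonde fun j => X j 1).det

/-- The Weyl weight `|Δ|²`. -/
noncomputable def weyl (N : ℕ) : LaurentAlg N := vand N * inv (vand N)

lemma inv_weyl : inv (weyl N) = weyl N := by
  rw [weyl, map_mul, inv_inv, mul_comm]

lemma vand_eq : vand N = ∏ i, ∏ j ∈ Finset.Ioi i, (X j 1 - X i 1 : LaurentAlg N) :=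
  Matrix.det_vandermonde _

lemma vand_ne_zero : vand N ≠ 0 := by
  rw [vand_eq]
  refine Finset.prod_ne_zero_iff.2 fun i _ => Finset.prod_ne_zero_iff.2 fun j hj => ?_
  rw [Finset.mem_Ioi] at hj
  rw [sub_ne_zero, X, X, Ne, AddMonoidAlgebra.single_left_inj one_ne_zero]
  intro h
  have := congrFun h j
  simp [hj.ne'] at this

lemma weyl_eq : weyl N = ∏ i, ∏ j ∈ Finset.Ioi i,
    ((X j 1 - X i 1) * (X j (-1) - X i (-1)) : LaurentAlg N) := by
  simp only [weyl, vand_eq, map_prod, map_sub, inv_X, Finset.prod_mul_distrib]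

lemma derivation_prod_of_log {ι A : Type*} [CommRing A] [Algebra ℝ A] (D : Derivation ℝ A A)
    (s : Finset ι) (f g : ι → A) (h : ∀ i ∈ s, D (f i) = f i * g i) :
    D (∏ i ∈ s, f i) = (∏ i ∈ s, f i) * ∑ i ∈ s, g i := by
  classical
  induction s using Finset.induction_on with
  | empty => simp
  | insert a s ha ih =>
    rw [Finset.prod_insert ha, Derivation.leibniz, ih (fun i hi => h i (Finset.mem_insert_of_mem hi)),
      h a (Finset.mem_insert_self _ _), Finset.sum_insert ha]
    simp only [smul_eq_mul]; ring

lemma wittD_weyl_factor (n : ℕ) (i j : Fin N) :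
    wittD n ((X j 1 - X i 1) * (X j (-1) - X i (-1)) : LaurentAlg N) =
      (X j 1 - X i 1) * (X j (-1) - X i (-1)) *
        ((X i 1 + X j 1) * ∑ k ∈ Finset.range n, X i 1 ^ k * X j 1 ^ (n - 1 - k)) := by
  have hi : (X i 1 * X i (-1) : LaurentAlg N) = 1 := by simp [X_mul, X_zero]
  have hj : (X j 1 * X j (-1) : LaurentAlg N) = 1 := by simp [X_mul, X_zero]
  have hS := (Commute.all (X i 1) (X j 1)).geom_sum₂_mul n
  have e : ∀ (l : Fin N) (c : ℤ), wittD n (X l c) = (c : ℝ) • (X l 1 ^ n * X l c) := by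
    intro l c; rw [wittD_X, X_pow, X_mul]; simp
  rw [Derivation.leibniz]
  simp only [map_sub, e, smul_eq_mul]
  generalize (∑ k ∈ Finset.range n, X i 1 ^ k * X j 1 ^ (n - 1 - k) : LaurentAlg N) = S at *
  simp only [Int.cast_one, one_smul, Int.cast_neg, neg_smul]
  generalize (X i 1 : LaurentAlg N) = a at *
  generalize (X j 1 : LaurentAlg N) = b at *
  generalize (X i (-1) : LaurentAlg N) = a' at *
  generalize (X j (-1) : LaurentAlg N) = b' at *
  linear_combination ((b' - a') * (a + b)) * hS + (a ^ n - b ^ n) * (hj - hi)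

/-- The divergence of the vector field `wittD n` for a nonnegative index. -/
noncomputable def divNat (n : ℕ) : LaurentAlg N := ∑ k ∈ Finset.range n, psum k * psum (n - k)

lemma divNat_eq (n : ℕ) : (divNat n : LaurentAlg N) = (n : ℝ) • psum n +
    ∑ i, ∑ j ∈ Finset.Ioi i, (X i 1 + X j 1) * ∑ k ∈ Finset.range n, X i 1 ^ k * X j 1 ^ (n - 1 - k) := by
  have key : ∀ i j : Fin N, ((X i 1 + X j 1) * ∑ k ∈ Finset.range n, X i 1 ^ k * X j 1 ^ (n - 1 - k)) =
      ∑ k ∈ Finset.range n, X i k * X j (n - k) + ∑ k ∈ Finset.range n, X j k * X i (n - k) := by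
    intro i j
    rw [add_mul, add_comm, Finset.mul_sum, Finset.mul_sum]
    congr 1
    · refine Finset.sum_congr rfl fun k hk => ?_
      have : k < n := Finset.mem_range.1 hk
      rw [X_pow, X_pow, mul_left_comm, X_mul]; congr 2 <;> push_cast [Nat.cast_sub (show k ≤ n - 1 by omega), Nat.cast_sub (show 1 ≤ n by omega)] <;> ring
    · rw [← Finset.sum_range_reflect (fun k : ℕ => (X j k * X i (n - k) : LaurentAlg N))]
      refine Finset.sum_congr rfl fun k hk => ?_
      have : k < n := Finset.mem_range.1 hk
      rw [X_pow, X_pow, ← mul_assoc, X_mul, mul_comm]; congr 2 <;> push_cast [Nat.cast_sub (show k ≤ n - 1 by omega), Nat.cast_sub (show 1 ≤ n by omega)] <;> ring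
  simp only [key]
  have h1 : (divNat n : LaurentAlg N) = ∑ i, ∑ j, ∑ k ∈ Finset.range n, X i k * X j (n - k) := by
    simp only [divNat, psum, Finset.sum_mul_sum]
    rw [Finset.sum_comm]
    refine Finset.sum_congr rfl fun i _ => ?_
    rw [Finset.sum_comm]
  have h2 : ∀ f : Fin N → Fin N → LaurentAlg N, ∑ i, ∑ j, f i j =
      ∑ i, f i i + ∑ i, ∑ j ∈ Finset.Ioi i, (f i j + f j i) := by
    intro f
    have h3 : ∀ i, ∑ j, f i j = f i i + ∑ j ∈ Finset.Ioi i, f i j + ∑ j ∈ Finset.Iio i, f i j := by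
      intro i
      rw [← Finset.sum_filter_add_sum_filter_not Finset.univ (fun j => i < j), Finset.filter_lt_eq_Ioi]
      have : (Finset.univ.filter fun j => ¬ i < j) = insert i (Finset.Iio i) := by
        ext j; simp [le_iff_eq_or_lt]
      rw [this, Finset.sum_insert (by simp)]; ring
    simp only [h3, Finset.sum_add_distrib]
    rw [Finset.sum_sigma' (Finset.univ) (fun i => Finset.Iio i),
      Finset.sum_sigma' (Finset.univ) (fun i => Finset.Ioi i) (fun i j => f j i), add_assoc]
    congr 2
    refine Finset.sum_bij' (fun p _ => ⟨p.2, p.1⟩) (fun p _ => ⟨p.2, p.1⟩) ?_ ?_ ?_ ?_ ?_ <;> simp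
  rw [h1, h2]
  congr 1
  simp [X_mul, psum, Finset.smul_sum, Nat.cast_smul_eq_nsmul]

lemma wittD_weyl (n : ℕ) : ∑ j, euler j (X j n * weyl N) = weyl N * divNat n := by
  have h : wittD n (weyl N) = weyl N * ∑ i, ∑ j ∈ Finset.Ioi i,
      (X i 1 + X j 1) * ∑ k ∈ Finset.range n, X i 1 ^ k * X j 1 ^ (n - 1 - k) := by
    rw [weyl_eq]
    exact derivation_prod_of_log _ _ _ _ fun i _ =>
      derivation_prod_of_log _ _ _ _ fun j _ => wittD_weyl_factor n i j
  simp only [Derivation.leibniz, Finset.sum_add_distrib, euler_X, if_true, smul_eq_mul]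
  rw [← wittD_apply, h, divNat_eq, mul_add, add_comm, psum, Finset.smul_sum, Finset.mul_sum]
  simp [Finset.mul_sum]

/-- The divergence of `wittD n` with respect to the Weyl weight. -/
noncomputable def div (n : ℤ) : LaurentAlg N :=
  if 0 ≤ n then divNat n.toNat else - inv (divNat (-n).toNat)

lemma euler_weyl (n : ℤ) : ∑ j, euler j (X j n * weyl N) = weyl N * div n := by
  by_cases hn : 0 ≤ n
  · obtain ⟨k, rfl⟩ := Int.eq_ofNat_of_zero_le hn
    simpa only [div, if_pos hn, Int.toNat_natCast] using wittD_weyl k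
  · obtain ⟨k, hk⟩ := Int.eq_ofNat_of_zero_le (show 0 ≤ -n by omega)
    obtain rfl : n = -k := by omega
    have h : ∀ j, euler j (X j (-k) * weyl N) = - inv (euler j (X j k * weyl N)) := by
      intro j; rw [← euler_inv, map_mul inv, inv_X, inv_weyl]
    simp only [h, Finset.sum_neg_distrib, ← map_sum, wittD_weyl, map_mul, inv_weyl, div, if_neg hn]
    simp

lemma CT_parts (n : ℤ) (G Q : LaurentAlg N) :
    CT ((div n * G + wittD n G) * Q * weyl N) = - CT (G * wittD n Q * weyl N) := by
  have h : ∑ j, euler j (X j n * weyl N * (G * Q)) =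
      (div n * G + wittD n G) * Q * weyl N + G * wittD n Q * weyl N := by
    have : ∀ j, euler j (X j n * weyl N * (G * Q)) = (X j n * weyl N) * (euler j (G * Q)) +
        G * Q * euler j (X j n * weyl N) := fun j => Derivation.leibniz _ _ _
    simp only [this, Finset.sum_add_distrib, ← Finset.mul_sum, euler_weyl]
    simp only [wittD_apply, Derivation.leibniz, smul_eq_mul, mul_add, add_mul, Finset.sum_mul,
      Finset.mul_sum, Finset.sum_add_distrib]
    have h1 : ∀ j, X j n * weyl N * (G * euler j Q) = G * (X j n * euler j Q) * weyl N := by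
      intro; ring
    have h2 : ∀ j, X j n * weyl N * (Q * euler j G) = X j n * euler j G * Q * weyl N := by
      intro; ring
    simp only [h1, h2]; ring
  have h' := congrArg CT h
  rw [map_sum, map_add] at h'
  simp only [CT_euler, Finset.sum_const_zero] at h'
  linarith

end LaurentAlg

namespace LaurentAlg

variable {N : ℕ}

/-- The product of power sums indexed by a list. -/
noncomputable def psumProd (l : List ℤ) : LaurentAlg N := (l.map psum).prod

@[simp] lemma psumProd_nil : (psumProd [] : LaurentAlg N) = 1 := rfl

@[simp] lemma psumProd_cons (m : ℤ) (l : List ℤ) :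
    (psumProd (m :: l) : LaurentAlg N) = psum m * psumProd l := by simp [psumProd]

lemma psumProd_append (l l' : List ℤ) :
    (psumProd (l ++ l') : LaurentAlg N) = psumProd l * psumProd l' := by simp [psumProd]

lemma inv_psumProd (l : List ℤ) :
    inv (psumProd l : LaurentAlg N) = psumProd (l.map Neg.neg) := by
  induction l with
  | nil => simp
  | cons m l ih => simp [ih, inv_psum]

/-- The total absolute degree of a list of exponents. -/
def absDegree (l : List ℤ) : ℕ := (l.map Int.natAbs).sum

@[simp] lemma absDegree_nil : absDegree [] = 0 := rfl

@[simp] lemma absDegree_cons (m : ℤ) (l : List ℤ) :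
    absDegree (m :: l) = m.natAbs + absDegree l := by simp [absDegree]

lemma absDegree_append (l l' : List ℤ) :
    absDegree (l ++ l') = absDegree l + absDegree l' := by simp [absDegree]

lemma absDegree_map_neg (l : List ℤ) : absDegree (l.map Neg.neg) = absDegree l := by
  induction l with
  | nil => simp
  | cons m l ih => simp [ih]

/-- The span of the products of power sums of absolute degree at most `d`. -/
noncomputable def psumSpan (N d : ℕ) : Submodule ℝ (LaurentAlg N) :=
  Submodule.span ℝ (psumProd '' {l | absDegree l ≤ d})

lemma psumProd_mem {d : ℕ} {l : List ℤ} (h : absDegree l ≤ d) : psumProd l ∈ psumSpan N d :=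
  Submodule.subset_span ⟨l, h, rfl⟩

lemma psum_mem {d : ℕ} {m : ℤ} (h : m.natAbs ≤ d) : psum m ∈ psumSpan N d := by
  have := psumProd_mem (N := N) (l := [m]) (d := d) (by simpa using h)
  simpa using this

lemma one_mem (d : ℕ) : 1 ∈ psumSpan N d := by
  simpa using psumProd_mem (N := N) (l := []) (d := d) (by simp)

lemma mul_mem_psumSpan {a b d : ℕ} (h : a + b ≤ d) {F G : LaurentAlg N} (hF : F ∈ psumSpan N a)
    (hG : G ∈ psumSpan N b) : F * G ∈ psumSpan N d := by
  have : psumSpan N a * psumSpan N b ≤ psumSpan N d := by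
    rw [psumSpan, psumSpan, Submodule.span_mul_span, Submodule.span_le]
    rintro _ ⟨_, ⟨l, hl, rfl⟩, _, ⟨l', hl', rfl⟩, rfl⟩
    simp only [Set.mem_ofPred_eq] at hl hl'
    show psumProd l * psumProd l' ∈ psumSpan N d
    rw [← psumProd_append]
    exact psumProd_mem (by rw [absDegree_append]; omega)
  exact this (Submodule.mul_mem_mul hF hG)

lemma inv_mem_psumSpan {d : ℕ} {F : LaurentAlg N} (hF : F ∈ psumSpan N d) :
    inv F ∈ psumSpan N d := by
  induction hF using Submodule.span_induction with
  | mem x hx =>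
    obtain ⟨l, hl, rfl⟩ := hx
    rw [inv_psumProd]
    exact psumProd_mem (by rw [absDegree_map_neg]; exact hl)
  | zero => simp
  | add x y _ _ hx hy => rw [map_add]; exact add_mem hx hy
  | smul a x _ hx => rw [map_smul]; exact Submodule.smul_mem _ _ hx

lemma divNat_mem (n : ℕ) : divNat n ∈ psumSpan N n := by
  refine Submodule.sum_mem _ fun k hk => ?_
  have : k < n := Finset.mem_range.1 hk
  exact mul_mem_psumSpan (a := k) (b := n - k) (by omega) (psum_mem (by omega))
    (psum_mem (by omega))

lemma div_mem (n : ℤ) : div n ∈ psumSpan N n.natAbs := by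
  unfold div
  split_ifs with h
  · convert divNat_mem (N := N) n.toNat using 2; omega
  · convert neg_mem (inv_mem_psumSpan (divNat_mem (N := N) (-n).toNat)) using 2; omega

lemma wittD_psumProd_mem (n : ℤ) (l : List ℤ) :
    wittD n (psumProd l) ∈ psumSpan N (n.natAbs + absDegree l) := by
  induction l with
  | nil => simp
  | cons m l ih =>
    rw [psumProd_cons, Derivation.leibniz, wittD_psum, absDegree_cons]
    refine add_mem ?_ ?_
    · exact mul_mem_psumSpan (a := m.natAbs) (b := n.natAbs + absDegree l) (by omega)
        (psum_mem le_rfl) ih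
    · rw [smul_eq_mul, mul_smul_comm]
      refine Submodule.smul_mem _ _ ?_
      exact mul_mem_psumSpan (a := absDegree l) (b := n.natAbs + m.natAbs) (by omega)
        (psumProd_mem le_rfl) (psum_mem (by omega))

instance (d : ℕ) : FiniteDimensional ℝ (psumSpan N d) := by
  let T : ℕ → Submodule ℝ (LaurentAlg N) := fun d => Submodule.span ℝ
    ((fun e => AddMonoidAlgebra.single e 1) '' Set.Icc (fun _ : Fin N => -(d : ℤ)) (fun _ => (d : ℤ)))
  have hT : ∀ d, FiniteDimensional ℝ (T d) := fun d =>
    FiniteDimensional.span_of_finite _ ((Set.finite_Icc _ _).image _)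
  have hmono : ∀ {a b}, a ≤ b → T a ≤ T b := by
    intro a b hab
    refine Submodule.span_mono (Set.image_mono (Set.Icc_subset_Icc ?_ ?_)) <;> intro i <;> simp [hab]
  have hmul : ∀ a b, T a * T b ≤ T (a + b) := by
    intro a b
    simp only [T]
    rw [Submodule.span_mul_span, Submodule.span_le]
    rintro _ ⟨_, ⟨e, he, rfl⟩, _, ⟨e', he', rfl⟩, rfl⟩
    refine Submodule.subset_span ⟨e + e', ⟨fun i => ?_, fun i => ?_⟩, ?_⟩
    · have h1 := he.1 i; have h2 := he'.1 i; simp at *; omega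
    · have h1 := he.2 i; have h2 := he'.2 i; simp at *; omega
    · simp [AddMonoidAlgebra.single_mul_single]
  have hp : ∀ l, psumProd l ∈ T (absDegree l) := by
    intro l
    induction l with
    | nil => exact Submodule.subset_span ⟨0, ⟨fun _ => by simp, fun _ => by simp⟩, by simp [AddMonoidAlgebra.one_def]⟩
    | cons m l ih =>
      rw [psumProd_cons, absDegree_cons]
      refine hmul _ _ (Submodule.mul_mem_mul ?_ ih)
      refine Submodule.sum_mem _ fun j _ => Submodule.subset_span ⟨Pi.single j m, ⟨fun i => ?_, fun i => ?_⟩, rfl⟩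
      · by_cases h : i = j
        · subst h; simp [neg_abs_le]
        · simp [h]
      · by_cases h : i = j
        · subst h; simp [le_abs_self]
        · simp [h]
  have hle : psumSpan N d ≤ T d := by
    rw [psumSpan, Submodule.span_le]
    rintro _ ⟨l, hl, rfl⟩
    exact hmono hl (hp l)
  exact Submodule.finiteDimensional_of_le hle

/-- Every functional satisfying the loop equations annihilates the Laplacian of `psumProd l`,
written here in weak form with an additional factor `psumProd l'`. -/
lemma exists_laplacian (ψ : LaurentAlg N →ₗ[ℝ] ℝ)
    (h : ∀ n l, ψ (div n * psumProd l + wittD n (psumProd l)) = 0) (l l' : List ℤ) :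
    ∃ R ∈ psumSpan N (absDegree l + absDegree l'), ψ R = 0 ∧ ∀ Q, CT (R * Q * weyl N) =
      - CT ((∑ j, euler j (psumProd l) * euler j Q) * psumProd l' * weyl N) := by
  induction l generalizing l' with
  | nil => exact ⟨0, by simp, by simp, by simp⟩
  | cons m l ih =>
    obtain ⟨R, hR, hψ, hCT⟩ := ih (m :: l')
    refine ⟨(m : ℝ) • (div m * psumProd (l ++ l') + wittD m (psumProd (l ++ l'))) + R, ?_, ?_, ?_⟩
    · rw [absDegree_cons] at *
      refine add_mem (Submodule.smul_mem _ _ (add_mem ?_ ?_)) ?_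
      · exact mul_mem_psumSpan (a := m.natAbs) (b := absDegree l + absDegree l') (by omega)
          (div_mem m) (psumProd_mem (by rw [absDegree_append]))
      · have := wittD_psumProd_mem (N := N) m (l ++ l')
        rwa [absDegree_append, ← add_assoc] at this
      · convert hR using 2; ring
    · rw [map_add, map_smul, h, hψ]; simp
    · intro Q
      rw [add_mul, add_mul, map_add, smul_mul_assoc, smul_mul_assoc, map_smul, CT_parts, hCT,
        smul_neg, ← map_smul, ← neg_add, ← map_add]
      congr 2
      have e : ∀ j : Fin N, euler j (psum m) = (m : ℝ) • X j m := by
        intro j; simp [psum, euler_X]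
      simp only [psumProd_append, psumProd_cons, Derivation.leibniz, e, wittD_apply, smul_eq_mul,
        add_mul, Finset.sum_add_distrib, Finset.mul_sum, Finset.sum_mul, Finset.smul_sum]
      rw [add_comm]
      congr 1
      · refine Finset.sum_congr rfl fun j _ => ?_
        ring
      · refine Finset.sum_congr rfl fun j _ => ?_
        simp only [mul_smul_comm, smul_mul_assoc]
        congr 1; ring

lemma eq_zero_of_CT_weyl {F : LaurentAlg N} (hF : CT (inv F * F * weyl N) = 0) : F = 0 := by
  have : inv F * F * weyl N = (F * vand N) * inv (F * vand N) := by
    rw [weyl, map_mul]; ring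
  rw [this] at hF
  exact (mul_eq_zero.1 (eq_zero_of_CT_mul_inv _ hF)).resolve_right vand_ne_zero

lemma CT_weyl_nonneg (F : LaurentAlg N) : 0 ≤ CT (inv F * F * weyl N) := by
  have : inv F * F * weyl N = (F * vand N) * inv (F * vand N) := by
    rw [weyl, map_mul]; ring
  rw [this]
  exact CT_mul_inv_nonneg _

/-- Riesz representation on `psumSpan N d` with respect to the Weyl weight. -/
lemma exists_density (ψ : LaurentAlg N →ₗ[ℝ] ℝ) (d : ℕ) :
    ∃ Q ∈ psumSpan N d, ∀ P ∈ psumSpan N d, ψ P = CT (P * Q * weyl N) := by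
  let B : psumSpan N d →ₗ[ℝ] Module.Dual ℝ (psumSpan N d) :=
    LinearMap.mk₂ ℝ (fun Q P => CT ((P : LaurentAlg N) * (Q : LaurentAlg N) * weyl N))
      (fun _ _ _ => by rw [Submodule.coe_add, mul_add, add_mul, map_add])
      (fun _ _ _ => by rw [Submodule.coe_smul, mul_smul_comm, smul_mul_assoc, map_smul])
      (fun _ _ _ => by rw [Submodule.coe_add, add_mul, add_mul, map_add])
      (fun _ _ _ => by rw [Submodule.coe_smul, smul_mul_assoc, smul_mul_assoc, map_smul])
  have hB : Function.Injective B := by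
    rw [injective_iff_map_eq_zero]
    intro Q hQ
    have := LinearMap.congr_fun hQ ⟨inv Q, inv_mem_psumSpan Q.2⟩
    exact Subtype.ext (eq_zero_of_CT_weyl this)
  have hB' : Function.Surjective B :=
    (LinearMap.injective_iff_surjective_of_finrank_eq_finrank
      (Subspace.dual_finrank_eq (K := ℝ) (V := psumSpan N d)).symm).1 hB
  obtain ⟨Q, hQ⟩ := hB' (ψ ∘ₗ (psumSpan N d).subtype)
  exact ⟨Q, Q.2, fun P hP => (LinearMap.congr_fun hQ ⟨P, hP⟩).symm⟩

lemma psumSpan_mono {a b : ℕ} (h : a ≤ b) : psumSpan N a ≤ psumSpan N b := by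
  unfold psumSpan
  exact Submodule.span_mono (Set.image_mono fun l (hl : absDegree l ≤ a) => hl.trans h)

lemma laplacian_density {ψ : LaurentAlg N →ₗ[ℝ] ℝ}
    (h : ∀ n l, ψ (div n * psumProd l + wittD n (psumProd l)) = 0) {d : ℕ} {Q : LaurentAlg N}
    (hQ : ∀ P ∈ psumSpan N d, ψ P = CT (P * Q * weyl N)) {P : LaurentAlg N}
    (hP : P ∈ psumSpan N d) : CT ((∑ j, euler j P * euler j Q) * weyl N) = 0 := by
  let T : LaurentAlg N →ₗ[ℝ] ℝ := ∑ j, CT ∘ₗ LinearMap.mulRight ℝ (weyl N) ∘ₗ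
    LinearMap.mulRight ℝ (euler j Q) ∘ₗ (euler j : LaurentAlg N →ₗ[ℝ] LaurentAlg N)
  have hT : ∀ P, T P = CT ((∑ j, euler j P * euler j Q) * weyl N) := by
    intro P
    rw [Finset.sum_mul, map_sum, LinearMap.sum_apply]
    rfl
  have hle : psumSpan N d ≤ LinearMap.ker T := by
    rw [psumSpan, Submodule.span_le]
    rintro _ ⟨l₁, hl, rfl⟩
    rw [Set.mem_ofPred_eq] at hl
    obtain ⟨R, hR, hψ, hCT⟩ := exists_laplacian ψ h l₁ []
    have hR' : R ∈ psumSpan N d := psumSpan_mono (by simpa using hl) hR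
    have hz : T (psumProd l₁) = 0 := by
      rw [hT, ← neg_eq_zero, ← mul_one (∑ j, euler j (psumProd l₁) * euler j Q), ← psumProd_nil,
        ← hCT Q, ← hQ R hR', hψ]
    exact hz
  rw [← hT]
  exact hle hP

lemma euler_density {ψ : LaurentAlg N →ₗ[ℝ] ℝ}
    (h : ∀ n l, ψ (div n * psumProd l + wittD n (psumProd l)) = 0) {d : ℕ} {Q : LaurentAlg N}
    (hQm : Q ∈ psumSpan N d) (hQ : ∀ P ∈ psumSpan N d, ψ P = CT (P * Q * weyl N)) (j : Fin N) :
    euler j Q = 0 := by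
  have h0 := laplacian_density h hQ (inv_mem_psumSpan hQm)
  have h1 : ∑ j, CT (inv (euler j Q) * euler j Q * weyl N) = 0 := by
    rw [← neg_eq_zero, ← Finset.sum_neg_distrib, ← h0, Finset.sum_mul, map_sum]
    refine Finset.sum_congr rfl fun j _ => ?_
    rw [euler_inv, neg_mul, neg_mul, map_neg]
  rw [Finset.sum_eq_zero_iff_of_nonneg fun j _ => CT_weyl_nonneg _] at h1
  exact eq_zero_of_CT_weyl (h1 j (Finset.mem_univ j))

/-- The loop equations determine a functional on products of power sums up to normalisation:
it is given by the Weyl integration formula. -/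
theorem loop_equations_unique (ψ : LaurentAlg N →ₗ[ℝ] ℝ)
    (h : ∀ n l, ψ (div n * psumProd l + wittD n (psumProd l)) = 0) (l : List ℤ) :
    ψ (psumProd l) * CT (weyl N) = ψ 1 * CT (psumProd l * weyl N) := by
  obtain ⟨Q, hQm, hQ⟩ := exists_density ψ (absDegree l)
  have hc := eq_const_of_euler _ (euler_density h hQm hQ)
  have hl : ψ (psumProd l) = Q.coeff 0 * CT (psumProd l * weyl N) := by
    rw [hQ _ (psumProd_mem le_rfl), hc]; simp
  have h1 : ψ 1 = Q.coeff 0 * CT (weyl N) := by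
    rw [hQ _ (one_mem _), hc]; simp
  rw [hl, h1]; ring

end LaurentAlg

namespace UnitaryMoments

open Module.End in
/-- A normal matrix is diagonalisable. -/
lemma exists_eigenbasis {N : ℕ} (A : Matrix (Fin N) (Fin N) ℂ) (hA : IsStarNormal A) :
    ∃ (b : Module.Basis (Fin N) ℂ (EuclideanSpace ℂ (Fin N))) (z : Fin N → ℂ),
      ∀ j, A.toEuclideanLin (b j) = z j • b j := by
  have hR : (Matrix.toEuclideanLin (realPart A : Matrix (Fin N) (Fin N) ℂ)).IsSymmetric :=
    Matrix.isSymmetric_toEuclideanLin_iff.2 (realPart A).2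
  have hI : (Matrix.toEuclideanLin (imaginaryPart A : Matrix (Fin N) (Fin N) ℂ)).IsSymmetric :=
    Matrix.isSymmetric_toEuclideanLin_iff.2 (imaginaryPart A).2
  have hc : Commute (Matrix.toEuclideanLin (realPart A : Matrix (Fin N) (Fin N) ℂ))
      (Matrix.toEuclideanLin (imaginaryPart A : Matrix (Fin N) (Fin N) ℂ)) :=
    (Commute.realPart_imaginaryPart A).map (Matrix.toLpLinAlgEquiv 2)
  have h := LinearMap.IsSymmetric.directSum_isInternal_of_commute hR hI hc
  let b := h.collectedBasis fun i => Module.finBasis ℂ _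
  let e := b.indexEquiv (EuclideanSpace.basisFun (Fin N) ℂ).toBasis
  refine ⟨b.reindex e, fun j => (e.symm j).1.2 + Complex.I * (e.symm j).1.1, fun j => ?_⟩
  have hm := h.collectedBasis_mem (fun i => Module.finBasis ℂ _) (e.symm j)
  rw [Submodule.mem_inf, mem_eigenspace_iff, mem_eigenspace_iff] at hm
  rw [Module.Basis.reindex_apply]
  have hd : Matrix.toEuclideanLin A =
      Matrix.toEuclideanLin (realPart A + Complex.I • imaginaryPart A : Matrix (Fin N) (Fin N) ℂ) := by
    rw [realPart_add_I_smul_imaginaryPart A]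
  rw [hd, map_add, map_smul, LinearMap.add_apply, LinearMap.smul_apply, hm.1, hm.2, smul_smul, add_smul]

lemma exists_eigenvalues {N : ℕ} (U : Matrix.unitaryGroup (Fin N) ℂ) :
    ∃ z : Fin N → ℂˣ, ∀ n : ℤ,
      Matrix.trace ((U ^ n : Matrix.unitaryGroup (Fin N) ℂ) : Matrix (Fin N) (Fin N) ℂ) =
        ∑ j, ((z j ^ n : ℂˣ) : ℂ) := by
  obtain ⟨b, z, hz⟩ := exists_eigenbasis (U : Matrix (Fin N) (Fin N) ℂ)
    ⟨by rw [Commute, SemiconjBy, U.2.1, U.2.2]⟩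
  let T : Matrix.unitaryGroup (Fin N) ℂ →* Module.End ℂ (EuclideanSpace ℂ (Fin N)) :=
    ((Matrix.toLpLinAlgEquiv (R := ℂ) (n := Fin N) 2 : _ →* _)).comp
      (Matrix.unitaryGroup (Fin N) ℂ).subtype
  have hT : ∀ j, T U (b j) = z j • b j := hz
  have hz0 : ∀ j, z j ≠ 0 := by
    intro j h0
    have h1 := hT j
    rw [h0, zero_smul] at h1
    have h2 : T U⁻¹ (T U (b j)) = b j := by
      rw [← Module.End.mul_apply, ← map_mul]; simp
    rw [h1, map_zero] at h2
    exact b.ne_zero j h2.symm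
  have hTi : ∀ j, T U⁻¹ (b j) = (z j)⁻¹ • b j := by
    intro j
    have h2 : T U⁻¹ (T U (b j)) = b j := by
      rw [← Module.End.mul_apply, ← map_mul]; simp
    rw [hT, map_smul] at h2
    rw [← h2, smul_smul, h2, inv_mul_cancel₀ (hz0 j), one_smul]
  have hTn : ∀ n : ℤ, ∀ j, T (U ^ n) (b j) = z j ^ n • b j := by
    intro n j
    have hp : ∀ (V : Matrix.unitaryGroup (Fin N) ℂ) (c : ℂ) (k : ℕ), T V (b j) = c • b j →
        T (V ^ k) (b j) = c ^ k • b j := by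
      intro V c k h
      induction k with
      | zero => simp
      | succ k ih => rw [pow_succ', map_mul, Module.End.mul_apply, ih, map_smul, h, smul_smul, pow_succ]
    obtain ⟨k, rfl | rfl⟩ := n.eq_nat_or_neg
    · simpa using hp U _ k (hT j)
    · simpa using hp U⁻¹ _ k (hTi j)
  refine ⟨fun j => Units.mk0 (z j) (hz0 j), fun n => ?_⟩
  have h1 : Matrix.trace ((U ^ n : Matrix.unitaryGroup (Fin N) ℂ) : Matrix (Fin N) (Fin N) ℂ) =
      LinearMap.trace ℂ _ (T (U ^ n)) := by
    rw [LinearMap.trace_eq_matrix_trace ℂ (PiLp.basisFun 2 ℂ (Fin N))]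
    congr 1
    show _ = LinearMap.toMatrix _ _ (Matrix.toLpLin 2 2 _)
    rw [Matrix.toLpLin_eq_toLin, LinearMap.toMatrix_toLin]
    rfl
  rw [h1, LinearMap.trace_eq_matrix_trace ℂ b, Matrix.trace]
  refine Finset.sum_congr rfl fun j _ => ?_
  simp [LinearMap.toMatrix_apply, hTn]

end UnitaryMoments

namespace UnitaryMoments

variable {N : ℕ}

instance : BorelSpace (Matrix.unitaryGroup (Fin N) ℂ) := ⟨rfl⟩

instance : CompactSpace (Matrix.unitaryGroup (Fin N) ℂ) := by
  refine isCompact_iff_compactSpace.1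
    (?_ : IsCompact (Matrix.unitaryGroup (Fin N) ℂ : Set (Matrix (Fin N) (Fin N) ℂ)))
  have hK : IsCompact (Set.univ.pi fun _ => Set.univ.pi fun _ => Metric.closedBall 0 1 :
      Set (Matrix (Fin N) (Fin N) ℂ)) :=
    isCompact_univ_pi fun _ => isCompact_univ_pi fun _ => isCompact_closedBall _ _
  refine hK.of_isClosed_subset ?_ fun U hU i _ j _ => ?_
  · have : (Matrix.unitaryGroup (Fin N) ℂ : Set (Matrix (Fin N) (Fin N) ℂ)) =
        {A | star A * A = 1} := by
      ext A; exact Matrix.mem_unitaryGroup_iff'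
    rw [this]
    exact isClosed_eq (by fun_prop) continuous_const
  · rw [mem_closedBall_zero_iff]
    exact entry_norm_bound_of_unitary hU i j

lemma continuous_entry (n : ℤ) (i j : Fin N) :
    Continuous fun U : Matrix.unitaryGroup (Fin N) ℂ => (U ^ n).1 i j := by
  have h : Continuous fun U : Matrix.unitaryGroup (Fin N) ℂ => U ^ n := continuous_zpow n
  have h' : Continuous fun A : Matrix (Fin N) (Fin N) ℂ => A i j := continuous_apply_apply i j
  exact h'.comp (continuous_subtype_val.comp h)

lemma integrable_of_continuous {μ : Measure (Matrix.unitaryGroup (Fin N) ℂ)} [IsFiniteMeasure μ]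
    {H : Matrix.unitaryGroup (Fin N) ℂ → ℂ} (hH : Continuous H) : Integrable H μ :=
  hH.integrable_of_hasCompactSupport (HasCompactSupport.of_compactSpace H)

/-- The one-parameter subgroup generated by a skew-Hermitian matrix. -/
noncomputable def oneParam (X : Matrix (Fin N) (Fin N) ℂ) (hX : star X = -X) (t : ℝ) :
    Matrix.unitaryGroup (Fin N) ℂ :=
  ⟨NormedSpace.exp (t • X), by
    have h : star (NormedSpace.exp (t • X)) = NormedSpace.exp (-(t • X)) := by
      rw [Matrix.star_eq_conjTranspose, ← Matrix.exp_conjTranspose, ← Matrix.star_eq_conjTranspose,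
        star_smul, hX, star_trivial, smul_neg]
    rw [Matrix.mem_unitaryGroup_iff', h,
      ← Matrix.exp_add_of_commute _ _ (Commute.refl (t • X)).neg_left,
      neg_add_cancel, NormedSpace.exp_zero]⟩

lemma oneParam_zero (X : Matrix (Fin N) (Fin N) ℂ) (hX : star X = -X) : oneParam X hX 0 = 1 :=
  Subtype.ext (by simp [oneParam])

lemma oneParam_add (X : Matrix (Fin N) (Fin N) ℂ) (hX : star X = -X) (s t : ℝ) :
    oneParam X hX (s + t) = oneParam X hX s * oneParam X hX t :=
  Subtype.ext (by
    simp only [oneParam, Submonoid.mk_mul_mk, add_smul]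
    exact Matrix.exp_add_of_commute _ _ (((Commute.refl X).smul_left s).smul_right t))

/-- Entrywise differentiability at `0` of a curve of matrices. -/
def HasEntryDeriv (A : ℝ → Matrix (Fin N) (Fin N) ℂ) (A' : Matrix (Fin N) (Fin N) ℂ) : Prop :=
  ∀ i j, HasDerivAt (fun t => A t i j) (A' i j) 0

lemma hasEntryDeriv_oneParam (X : Matrix (Fin N) (Fin N) ℂ) (hX : star X = -X) :
    HasEntryDeriv (fun t => (oneParam X hX t).1) X := by
  intro i j
  let := Matrix.linftyOpNormedRing (n := Fin N) (α := ℂ)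
  let := Matrix.linftyOpNormedAlgebra (n := Fin N) (R := ℝ) (α := ℂ)
  have h := hasDerivAt_exp_smul_const (𝕂 := ℝ) X (0 : ℝ)
  rw [zero_smul, NormedSpace.exp_zero, one_mul] at h
  exact hasDerivAt_pi.1 (hasDerivAt_pi.1 h i) j

lemma HasEntryDeriv.mul {A B : ℝ → Matrix (Fin N) (Fin N) ℂ} {A' B' : Matrix (Fin N) (Fin N) ℂ}
    (hA : HasEntryDeriv A A') (hB : HasEntryDeriv B B') :
    HasEntryDeriv (fun t => A t * B t) (A' * B 0 + A 0 * B') := by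
  intro i j
  simp only [Matrix.mul_apply, Matrix.add_apply, ← Finset.sum_add_distrib]
  exact HasDerivAt.fun_sum fun k _ => (hA i k).mul (hB k j)

lemma hasEntryDeriv_const (A : Matrix (Fin N) (Fin N) ℂ) : HasEntryDeriv (fun _ => A) 0 :=
  fun _ _ => hasDerivAt_const _ _

lemma HasEntryDeriv.trace {A : ℝ → Matrix (Fin N) (Fin N) ℂ} {A' : Matrix (Fin N) (Fin N) ℂ}
    (hA : HasEntryDeriv A A') : HasDerivAt (fun t => (A t).trace) A'.trace 0 :=
  HasDerivAt.fun_sum fun k _ => hA k k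

/-- Left-invariance of the Haar measure in infinitesimal form. -/
lemma integral_deriv_eq_zero (μ : Measure (Matrix.unitaryGroup (Fin N) ℂ)) [IsFiniteMeasure μ]
    [μ.IsMulLeftInvariant] (X : Matrix (Fin N) (Fin N) ℂ) (hX : star X = -X)
    {H H' : Matrix.unitaryGroup (Fin N) ℂ → ℂ} (hH : Continuous H) (hH' : Continuous H')
    (hd : ∀ U, HasDerivAt (fun t => H (oneParam X hX t * U)) (H' U) 0) : ∫ U, H' U ∂μ = 0 := by
  obtain ⟨C, hC⟩ := isCompact_univ.exists_bound_of_continuousOn hH'.continuousOn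
  have hdt : ∀ U t, HasDerivAt (fun t => H (oneParam X hX t * U)) (H' (oneParam X hX t * U)) t := by
    intro U t
    have h := hd (oneParam X hX t * U)
    have h2 : HasDerivAt (fun s : ℝ => s - t) 1 t := (hasDerivAt_id t).sub_const t
    have h3 := HasDerivAt.scomp_of_eq (h := fun s => s - t) t h h2 (sub_self t).symm
    rw [one_smul] at h3
    refine (h3.congr_of_eventuallyEq (Eventually.of_forall fun s => ?_))
    simp only [Function.comp]
    rw [← mul_assoc, ← oneParam_add, sub_add_cancel]
  have hmul : ∀ {F : Matrix.unitaryGroup (Fin N) ℂ → ℂ} (t : ℝ), Continuous F →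
      Continuous fun U => F (oneParam X hX t * U) := fun t hF => hF.comp (continuous_const_mul _)
  have key := hasDerivAt_integral_of_dominated_loc_of_deriv_le (μ := μ) (x₀ := (0 : ℝ))
    (F := fun t U => H (oneParam X hX t * U)) (F' := fun t U => H' (oneParam X hX t * U))
    (bound := fun _ => C) (s := Set.univ) univ_mem
    (Eventually.of_forall fun t => (hmul t hH).aestronglyMeasurable)
    (integrable_of_continuous (hmul 0 hH)) (hmul 0 hH').aestronglyMeasurable
    (Eventually.of_forall fun U t _ => hC _ (Set.mem_univ _)) (integrable_const _)
    (Eventually.of_forall fun U t _ => hdt U t)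
  have h1 : (fun t => ∫ U, H (oneParam X hX t * U) ∂μ) = fun _ => ∫ U, H U ∂μ :=
    funext fun t => integral_mul_left_eq_self _ _
  rw [h1] at key
  have h2 := key.2.unique (hasDerivAt_const _ _)
  rwa [integral_mul_left_eq_self] at h2

end UnitaryMoments

namespace UnitaryMoments

variable {N : ℕ}

/-- The trace of the `n`-th power. -/
noncomputable def tr (n : ℤ) (U : Matrix.unitaryGroup (Fin N) ℂ) : ℂ := Matrix.trace (U ^ n).1

/-- The product of traces of powers indexed by a list of exponents. -/
noncomputable def trProd (l : List ℤ) (U : Matrix.unitaryGroup (Fin N) ℂ) : ℂ :=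
  (l.map fun n => tr n U).prod

@[simp] lemma trProd_nil (U : Matrix.unitaryGroup (Fin N) ℂ) : trProd [] U = 1 := rfl

@[simp] lemma trProd_cons (m : ℤ) (l : List ℤ) (U : Matrix.unitaryGroup (Fin N) ℂ) :
    trProd (m :: l) U = tr m U * trProd l U := by simp [trProd]

/-- The gradient of `trProd l` in the direction of right-invariant vector fields. -/
noncomputable def trGrad : List ℤ → Matrix.unitaryGroup (Fin N) ℂ → Matrix (Fin N) (Fin N) ℂ
  | [], _ => 0
  | m :: l, U => ((m : ℂ) * trProd l U) • (U ^ m).1 + tr m U • trGrad l U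

/-- The derivative of `trProd l` along the `n`-th Witt vector field. -/
noncomputable def trWitt (n : ℤ) : List ℤ → Matrix.unitaryGroup (Fin N) ℂ → ℂ
  | [], _ => 0
  | m :: l, U => (m : ℂ) * trProd l U * tr (n + m) U + tr m U * trWitt n l U

lemma trWitt_eq (n : ℤ) (l : List ℤ) (U : Matrix.unitaryGroup (Fin N) ℂ) :
    trWitt n l U = Matrix.trace ((U ^ n).1 * trGrad l U) := by
  induction l with
  | nil => simp [trWitt, trGrad]
  | cons m l ih =>
    simp only [trWitt, trGrad, ih, mul_add, Matrix.trace_add, mul_smul_comm, Matrix.trace_smul,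
      smul_eq_mul, tr, zpow_add, Submonoid.coe_mul]

lemma continuous_tr (n : ℤ) : Continuous (tr n : Matrix.unitaryGroup (Fin N) ℂ → ℂ) := by
  change Continuous fun U : Matrix.unitaryGroup (Fin N) ℂ => ∑ i, (U ^ n).1 i i
  exact continuous_finsetSum _ fun i _ => continuous_entry n i i

lemma continuous_trProd (l : List ℤ) :
    Continuous (trProd l : Matrix.unitaryGroup (Fin N) ℂ → ℂ) := by
  induction l with
  | nil => exact continuous_const
  | cons m l ih =>
    change Continuous fun U => trProd (m :: l) U
    simp only [trProd_cons]
    exact (continuous_tr m).mul ih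

lemma continuous_trGrad (l : List ℤ) (i j : Fin N) :
    Continuous fun U : Matrix.unitaryGroup (Fin N) ℂ => trGrad l U i j := by
  induction l with
  | nil => exact continuous_const
  | cons m l ih =>
    simp only [trGrad, Matrix.add_apply, Matrix.smul_apply, smul_eq_mul]
    exact ((continuous_const.mul (continuous_trProd l)).mul (continuous_entry m i j)).add
      ((continuous_tr m).mul ih)

lemma continuous_trWitt (n : ℤ) (l : List ℤ) :
    Continuous (trWitt n l : Matrix.unitaryGroup (Fin N) ℂ → ℂ) := by
  induction l with
  | nil => exact continuous_const
  | cons m l ih =>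
    exact ((continuous_const.mul (continuous_trProd l)).mul (continuous_tr _)).add
      ((continuous_tr m).mul ih)

lemma tr_neg (n : ℤ) (U : Matrix.unitaryGroup (Fin N) ℂ) : tr (-n) U = star (tr n U) := by
  rw [tr, tr, zpow_neg, ← Matrix.trace_conjTranspose]
  rfl

lemma tr_of_nonneg (n : ℕ) (U : Matrix.unitaryGroup (Fin N) ℂ) : tr n U = (U.1 ^ n).trace := by
  rw [tr, zpow_natCast, SubmonoidClass.coe_pow]

lemma trProd_neg (l : List ℤ) (U : Matrix.unitaryGroup (Fin N) ℂ) :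
    trProd (l.map Neg.neg) U = star (trProd l U) := by
  induction l with
  | nil => simp
  | cons m l ih => simp [ih, tr_neg]

lemma trWitt_neg (n : ℤ) (l : List ℤ) (U : Matrix.unitaryGroup (Fin N) ℂ) :
    trWitt (-n) (l.map Neg.neg) U = - star (trWitt n l U) := by
  induction l with
  | nil => simp [trWitt]
  | cons m l ih =>
    simp only [List.map_cons, trWitt, trProd_neg, ih, ← neg_add, tr_neg, star_add, star_mul']
    simp
    ring

section Deriv

variable (X : Matrix (Fin N) (Fin N) ℂ) (hX : star X = -X) (U : Matrix.unitaryGroup (Fin N) ℂ)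

lemma hasEntryDeriv_mul : HasEntryDeriv (fun t => (oneParam X hX t * U).1) (X * U.1) := by
  have := (hasEntryDeriv_oneParam X hX).mul (hasEntryDeriv_const U.1)
  simpa using this

lemma hasEntryDeriv_pow (n : ℕ) :
    HasEntryDeriv (fun t => (oneParam X hX t * U).1 ^ n)
      (∑ k ∈ Finset.range n, U.1 ^ k * X * U.1 ^ (n - k)) := by
  induction n with
  | zero => simpa using hasEntryDeriv_const (1 : Matrix (Fin N) (Fin N) ℂ)
  | succ n ih =>
    have h := ih.mul (hasEntryDeriv_mul X hX U)
    simp only [← pow_succ, oneParam_zero, one_mul] at h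
    convert h using 1
    rw [Finset.sum_range_succ, Finset.sum_mul, Nat.add_sub_cancel_left, pow_one, mul_assoc]
    congr 1
    refine Finset.sum_congr rfl fun k hk => ?_
    rw [mul_assoc _ _ U.1, ← pow_succ, Nat.succ_sub (Finset.mem_range.1 hk).le]

lemma hasDerivAt_tr_nat (n : ℕ) :
    HasDerivAt (fun t => tr n (oneParam X hX t * U)) (n * (X * U.1 ^ n).trace) 0 := by
  simp only [tr_of_nonneg]
  convert (hasEntryDeriv_pow X hX U n).trace using 1
  rw [Matrix.trace_sum, Finset.sum_congr rfl (g := fun _ => (X * U.1 ^ n).trace), Finset.sum_const]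
  · simp
  · intro k hk
    rw [mul_assoc, Matrix.trace_mul_comm, mul_assoc, ← pow_add,
      Nat.sub_add_cancel (Finset.mem_range.1 hk).le]

lemma hasDerivAt_tr (m : ℤ) :
    HasDerivAt (fun t => tr m (oneParam X hX t * U)) (m * (X * (U ^ m).1).trace) 0 := by
  obtain ⟨n, rfl | rfl⟩ := m.eq_nat_or_neg
  · simpa using hasDerivAt_tr_nat X hX U n
  · simp only [tr_neg]
    refine (hasDerivAt_tr_nat X hX U n).star.congr_deriv ?_
    have h : (U ^ (-(n : ℤ))).1 = star (U.1 ^ n) := by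
      rw [zpow_neg, zpow_natCast, ← SubmonoidClass.coe_pow]; rfl
    rw [h, star_mul', ← Matrix.trace_conjTranspose, ← Matrix.star_eq_conjTranspose, star_mul, hX,
      mul_neg, Matrix.trace_neg, Matrix.trace_mul_comm]
    simp

lemma hasDerivAt_trProd (l : List ℤ) :
    HasDerivAt (fun t => trProd l (oneParam X hX t * U)) (X * trGrad l U).trace 0 := by
  induction l with
  | nil => simpa [trGrad] using hasDerivAt_const (0 : ℝ) (1 : ℂ)
  | cons m l ih =>
    simp only [trProd_cons]
    refine ((hasDerivAt_tr X hX U m).mul ih).congr_deriv ?_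
    simp only [oneParam_zero, one_mul, trGrad, mul_add, Matrix.trace_add, mul_smul_comm,
      Matrix.trace_smul, smul_eq_mul]
    ring

end Deriv

/-- The derivative of `U ↦ (U ^ n) a b * trProd l U` in the direction `X`. -/
noncomputable def loopDeriv (n : ℕ) (l : List ℤ) (a b : Fin N) (X : Matrix (Fin N) (Fin N) ℂ)
    (U : Matrix.unitaryGroup (Fin N) ℂ) : ℂ :=
  (∑ k ∈ Finset.range n, U.1 ^ k * X * U.1 ^ (n - k)) a b * trProd l U +
    (U.1 ^ n) a b * (X * trGrad l U).trace

lemma continuous_pow_entry (n : ℕ) (i j : Fin N) :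
    Continuous fun U : Matrix.unitaryGroup (Fin N) ℂ => (U.1 ^ n) i j := by
  have := continuous_entry (N := N) n i j
  simpa using this

lemma continuous_loopDeriv (n : ℕ) (l : List ℤ) (a b : Fin N) (X : Matrix (Fin N) (Fin N) ℂ) :
    Continuous (loopDeriv n l a b X) := by
  unfold loopDeriv
  refine (Continuous.mul ?_ (continuous_trProd l)).add ((continuous_pow_entry n a b).mul ?_)
  · simp only [Matrix.sum_apply, Matrix.mul_apply]
    exact continuous_finsetSum _ fun k _ => continuous_finsetSum _ fun i _ =>
      (continuous_finsetSum _ fun j _ =>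
        (continuous_pow_entry k a j).mul continuous_const).mul (continuous_pow_entry _ i b)
  · simp only [Matrix.trace, Matrix.diag, Matrix.mul_apply]
    exact continuous_finsetSum _ fun k _ => continuous_finsetSum _ fun i _ =>
      continuous_const.mul (continuous_trGrad l i k)

lemma loopDeriv_add_smul (n : ℕ) (l : List ℤ) (a b : Fin N) (X Y : Matrix (Fin N) (Fin N) ℂ) (c : ℂ)
    (U : Matrix.unitaryGroup (Fin N) ℂ) :
    loopDeriv n l a b (X + c • Y) U = loopDeriv n l a b X U + c * loopDeriv n l a b Y U := by
  simp only [loopDeriv, mul_add, add_mul, mul_smul_comm, smul_mul_assoc, Finset.sum_add_distrib,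
    ← Finset.smul_sum, Matrix.add_apply, Matrix.smul_apply, Matrix.trace_add, Matrix.trace_smul,
    smul_eq_mul]
  ring

variable (μ : Measure (Matrix.unitaryGroup (Fin N) ℂ)) [IsFiniteMeasure μ] [μ.IsMulLeftInvariant]

lemma integral_loopDeriv_of_skew (n : ℕ) (l : List ℤ) (a b : Fin N)
    (X : Matrix (Fin N) (Fin N) ℂ) (hX : star X = -X) : ∫ U, loopDeriv n l a b X U ∂μ = 0 := by
  refine integral_deriv_eq_zero μ X hX
    (H := fun U => (U.1 ^ n) a b * trProd l U)
    ((continuous_pow_entry n a b).mul (continuous_trProd l)) (continuous_loopDeriv n l a b X)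
    fun U => ?_
  refine ((hasEntryDeriv_pow X hX U n a b).mul (hasDerivAt_trProd X hX U l)).congr_deriv ?_
  simp only [loopDeriv, oneParam_zero, one_mul]

lemma integral_loopDeriv (n : ℕ) (l : List ℤ) (a b : Fin N)
    (X : Matrix (Fin N) (Fin N) ℂ) : ∫ U, loopDeriv n l a b X U ∂μ = 0 := by
  have h : X = (1 / 2 : ℂ) • (X - star X) + Complex.I • ((-Complex.I / 2) • (X + star X)) := by
    have : Complex.I * (-Complex.I / 2) = 1 / 2 := by
      rw [← mul_div_assoc, mul_neg, Complex.I_mul_I]; simp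
    rw [smul_smul, this, ← smul_add, sub_add_add_cancel, ← two_smul ℂ, smul_smul]
    simp
  have h1 : star ((1 / 2 : ℂ) • (X - star X)) = -((1 / 2 : ℂ) • (X - star X)) := by
    rw [star_smul, star_sub, star_star, ← smul_neg, neg_sub]
    simp
  have h2 : star ((-Complex.I / 2) • (X + star X)) = -((-Complex.I / 2) • (X + star X)) := by
    rw [star_smul, star_add, star_star, ← neg_smul, add_comm]
    congr 1
    simp [neg_div]
  rw [h, integral_congr_ae (Eventually.of_forall fun U => loopDeriv_add_smul n l a b _ _ _ U),
    integral_add (integrable_of_continuous (continuous_loopDeriv _ _ _ _ _))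
    ((integrable_of_continuous (continuous_loopDeriv _ _ _ _ _)).const_mul _), integral_const_mul,
    integral_loopDeriv_of_skew μ n l a b _ h1, integral_loopDeriv_of_skew μ n l a b _ h2]
  simp

lemma sum_loopDeriv (n : ℕ) (l : List ℤ) (U : Matrix.unitaryGroup (Fin N) ℂ) :
    ∑ a, ∑ b, loopDeriv n l a b (Matrix.single a b 1) U =
      (∑ k ∈ Finset.range n, tr k U * tr (n - k) U) * trProd l U + trWitt n l U := by
  have e : ∀ k ∈ Finset.range n, tr k U * tr (n - k) U =
      ∑ a, ∑ b, (U.1 ^ k * Matrix.single a b 1 * U.1 ^ (n - k) : Matrix (Fin N) (Fin N) ℂ) a b := by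
    intro k hk
    rw [← Nat.cast_sub (Finset.mem_range.1 hk).le, tr_of_nonneg, tr_of_nonneg, Matrix.trace,
      Matrix.trace, Finset.sum_mul_sum]
    refine Finset.sum_congr rfl fun a _ => Finset.sum_congr rfl fun b _ => ?_
    rw [mul_assoc, Matrix.mul_apply, Finset.sum_eq_single a]
    · simp
    · intro c _ hc
      rw [Matrix.single_mul_apply_of_ne _ _ _ _ _ hc, mul_zero]
    · simp
  have e2 : trWitt n l U = ∑ a, ∑ b, (U.1 ^ n) a b * (Matrix.single a b 1 * trGrad l U).trace := by
    rw [trWitt_eq, zpow_natCast, SubmonoidClass.coe_pow, Matrix.trace]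
    simp [Matrix.mul_apply, Matrix.trace_single_mul]
  rw [Finset.sum_congr rfl e, e2]
  simp only [loopDeriv, Finset.sum_add_distrib, Finset.sum_mul, Matrix.sum_apply]
  congr 1
  symm
  rw [Finset.sum_comm]
  exact Finset.sum_congr rfl fun a _ => Finset.sum_comm

/-- The loop (Schwinger-Dyson) equations of the unitary group. -/
theorem loop_equation_nat (n : ℕ) (l : List ℤ) :
    ∫ U, ((∑ k ∈ Finset.range n, tr k U * tr (n - k) U) * trProd l U + trWitt n l U) ∂μ = 0 := by
  simp only [← sum_loopDeriv]
  rw [integral_finsetSum _ fun a _ => integrable_finsetSum _ fun b _ =>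
    integrable_of_continuous (continuous_loopDeriv _ _ _ _ _)]
  refine Finset.sum_eq_zero fun a _ => ?_
  rw [integral_finsetSum _ fun b _ =>
    integrable_of_continuous (continuous_loopDeriv _ _ _ _ _)]
  exact Finset.sum_eq_zero fun b _ => integral_loopDeriv μ _ _ _ _ _

end UnitaryMoments

namespace UnitaryMoments

open LaurentAlg

variable {N : ℕ}

/-- The eigenvalues of a unitary matrix. -/
noncomputable def eigen (U : Matrix.unitaryGroup (Fin N) ℂ) : Fin N → ℂˣ :=
  (exists_eigenvalues U).choose

/-- Evaluation of Laurent polynomials at the eigenvalues of a unitary matrix. -/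
noncomputable def evalEigen (U : Matrix.unitaryGroup (Fin N) ℂ) : LaurentAlg N →ₐ[ℝ] ℂ :=
  AddMonoidAlgebra.lift ℝ ℂ (Fin N → ℤ)
    { toFun := fun e => ((∏ j, eigen U j ^ (e.toAdd j) : ℂˣ) : ℂ)
      map_one' := by simp
      map_mul' := fun a b => by simp [zpow_add, Finset.prod_mul_distrib] }

lemma evalEigen_X (U : Matrix.unitaryGroup (Fin N) ℂ) (j : Fin N) (n : ℤ) :
    evalEigen U (X j n) = ((eigen U j ^ n : ℂˣ) : ℂ) := by
  rw [evalEigen, X, AddMonoidAlgebra.lift_single, one_smul]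
  simp only [MonoidHom.coe_mk, OneHom.coe_mk, toAdd_ofAdd]
  rw [Finset.prod_eq_single j] <;> simp +contextual

lemma evalEigen_psum (U : Matrix.unitaryGroup (Fin N) ℂ) (n : ℤ) :
    evalEigen U (psum n) = tr n U := by
  rw [psum, map_sum, tr, (exists_eigenvalues U).choose_spec n]
  exact Finset.sum_congr rfl fun j _ => evalEigen_X U j n

lemma evalEigen_psumProd (U : Matrix.unitaryGroup (Fin N) ℂ) (l : List ℤ) :
    evalEigen U (psumProd l) = trProd l U := by
  induction l with
  | nil => simp
  | cons m l ih => simp [ih, evalEigen_psum]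

lemma evalEigen_wittD (U : Matrix.unitaryGroup (Fin N) ℂ) (n : ℤ) (l : List ℤ) :
    evalEigen U (wittD n (psumProd l)) = trWitt n l U := by
  induction l with
  | nil => simp [trWitt]
  | cons m l ih =>
    rw [psumProd_cons, Derivation.leibniz, wittD_psum, map_add, smul_eq_mul, smul_eq_mul, map_mul,
      map_mul, map_smul, ih, evalEigen_psum, evalEigen_psum, evalEigen_psumProd, trWitt]
    simp only [Complex.real_smul, Complex.ofReal_intCast]
    ring

lemma evalEigen_divNat (U : Matrix.unitaryGroup (Fin N) ℂ) (n : ℕ) :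
    evalEigen U (divNat n) = ∑ k ∈ Finset.range n, tr k U * tr (n - k) U := by
  simp [divNat, evalEigen_psum]

lemma evalEigen_inv_divNat (U : Matrix.unitaryGroup (Fin N) ℂ) (n : ℕ) :
    evalEigen U (inv (divNat n)) = star (∑ k ∈ Finset.range n, tr k U * tr (n - k) U) := by
  simp only [divNat, map_sum, map_mul, inv_psum, evalEigen_psum, tr_neg, star_sum, star_mul']

lemma continuous_evalEigen_div (n : ℤ) : Continuous fun U => evalEigen (N := N) U (div n) := by
  have h : ∀ k : ℕ, Continuous fun U : Matrix.unitaryGroup (Fin N) ℂ =>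
      ∑ i ∈ Finset.range k, tr i U * tr (k - i) U := fun k =>
    continuous_finsetSum _ fun i _ => (continuous_tr _).mul (continuous_tr _)
  unfold div
  split_ifs
  · simp only [evalEigen_divNat]; exact h _
  · simp only [map_neg, evalEigen_inv_divNat]; exact (h _).star.neg

section

variable (μ : Measure (Matrix.unitaryGroup (Fin N) ℂ)) [IsFiniteMeasure μ] [μ.IsMulLeftInvariant]

theorem loop_equation (n : ℤ) (l : List ℤ) :
    ∫ U, evalEigen U (div n * psumProd l + wittD n (psumProd l)) ∂μ = 0 := by
  simp only [map_add, map_mul, evalEigen_psumProd, evalEigen_wittD]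
  by_cases hn : 0 ≤ n
  · obtain ⟨k, rfl⟩ := Int.eq_ofNat_of_zero_le hn
    simp only [div, if_pos hn, Int.toNat_natCast, evalEigen_divNat]
    exact loop_equation_nat μ k l
  · obtain ⟨k, hk⟩ := Int.eq_ofNat_of_zero_le (show 0 ≤ -n by omega)
    obtain rfl : n = -k := by omega
    have h := loop_equation_nat μ k (l.map Neg.neg)
    have h2 := congrArg (fun z : ℂ => -star z) h
    simp only [star_zero, neg_zero] at h2
    rw [← h2, RCLike.star_def, ← integral_conj, ← integral_neg]
    refine integral_congr_ae (Eventually.of_forall fun U => ?_)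
    have h3 := trWitt_neg k (l.map Neg.neg) U
    have h4 := trProd_neg (l.map Neg.neg) U
    have h5 : (l.map Neg.neg).map Neg.neg = l := by simp
    rw [h5] at h3 h4
    simp only [div, if_neg hn, neg_neg, Int.toNat_natCast, map_neg, evalEigen_inv_divNat, h3, h4,
      ← RCLike.star_def, star_add, star_mul', star_sum, map_neg]
    ring

end

/-- The functionals `F ↦ L (∫ F(eigenvalues))` on symmetric Laurent polynomials. -/
lemma exists_functional (μ : Measure (Matrix.unitaryGroup (Fin N) ℂ)) [IsFiniteMeasure μ]
    (L : ℂ →ₗ[ℝ] ℝ) : ∃ ψ : LaurentAlg N →ₗ[ℝ] ℝ, ∀ F,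
      (Continuous fun U => evalEigen U F) → ψ F = L (∫ U, evalEigen U F ∂μ) := by
  let C : Submodule ℝ (LaurentAlg N) :=
    { carrier := {F | Continuous fun U => evalEigen U F}
      add_mem' := fun {F G} (hF : Continuous _) (hG : Continuous _) => by
        change Continuous fun U => evalEigen U (F + G)
        simp only [map_add]
        exact hF.add hG
      zero_mem' := by
        change Continuous fun U => evalEigen U (0 : LaurentAlg N)
        simp only [map_zero]
        exact continuous_const
      smul_mem' := fun c F (hF : Continuous _) => by
        change Continuous fun U => evalEigen U (c • F)
        simp only [map_smul]
        exact hF.const_smul c }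
  let ψ₀ : C →ₗ[ℝ] ℂ :=
    { toFun := fun F => ∫ U, evalEigen U F.1 ∂μ
      map_add' := fun F G => by
        simp only [Submodule.coe_add, map_add]
        exact integral_add (integrable_of_continuous F.2) (integrable_of_continuous G.2)
      map_smul' := fun c F => by
        simp only [Submodule.coe_smul, map_smul, RingHom.id_apply]
        exact integral_smul _ _ }
  obtain ⟨ψ, hψ⟩ := (L ∘ₗ ψ₀).exists_extend
  exact ⟨ψ, fun F hF => LinearMap.congr_fun hψ ⟨F, hF⟩⟩

/-- The Weyl integration formula for products of traces of powers. -/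
theorem weyl_integration (μ : Measure (Matrix.unitaryGroup (Fin N) ℂ)) [IsProbabilityMeasure μ]
    [μ.IsMulLeftInvariant] (l : List ℤ) :
    (∫ U, trProd l U ∂μ) * (CT (weyl N) : ℂ) = (CT (psumProd l * weyl N) : ℂ) := by
  have key : ∀ L : ℂ →ₗ[ℝ] ℝ, L (∫ U, trProd l U ∂μ) * CT (weyl N) =
      L 1 * CT (psumProd l * weyl N) := by
    intro L
    obtain ⟨ψ, hψ⟩ := exists_functional μ L
    have hc : ∀ l : List ℤ, Continuous fun U => evalEigen (N := N) U (psumProd l) := by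
      intro l
      simp only [evalEigen_psumProd]
      exact continuous_trProd l
    have h := loop_equations_unique ψ (fun n l => ?_) l
    · rw [hψ _ (hc l)] at h
      simp only [evalEigen_psumProd] at h
      have h1 := hψ _ (hc [])
      simp only [psumProd_nil, map_one, integral_const, probReal_univ, one_smul] at h1
      rwa [h1] at h
    · rw [hψ, loop_equation, map_zero]
      simp only [map_add, map_mul, evalEigen_wittD]
      exact ((continuous_evalEigen_div n).mul (hc l)).add (continuous_trWitt n l)
  have h1 := key Complex.reLm
  have h2 := key Complex.imLm
  apply Complex.ext
  · simpa using h1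
  · simpa using h2

end UnitaryMoments

namespace CanonicalSurjection

/-- Canonical surjections `Fin m → Fin r`, in bijection with partitions into `r` blocks. -/
def IsCanonical {m r : ℕ} (σ : Fin m → Fin r) : Prop :=
  Function.Surjective σ ∧ ∀ j, (σ j : ℕ) = 0 ∨ ∃ k, k < j ∧ (σ j : ℕ) = (σ k : ℕ) + 1

variable {m r r' : ℕ}

lemma IsCanonical.exists_lt {σ : Fin m → Fin r} (h : IsCanonical σ) (j : Fin m) (v : ℕ)
    (hv : v < σ j) : ∃ k < j, (σ k : ℕ) = v := by
  obtain ⟨d, hd⟩ : ∃ d, v + d + 1 = σ j := ⟨σ j - v - 1, by omega⟩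
  induction d generalizing j with
  | zero =>
    obtain h0 | ⟨k, hk, e⟩ := h.2 j
    · omega
    · exact ⟨k, hk, by omega⟩
  | succ d ih =>
    obtain h0 | ⟨k, hk, e⟩ := h.2 j
    · omega
    · obtain ⟨k', hk', e'⟩ := ih k (by omega) (by omega)
      exact ⟨k', hk'.trans hk, e'⟩

lemma IsCanonical.val_le {σ : Fin m → Fin r} {σ' : Fin m → Fin r'} (h : IsCanonical σ)
    (j : Fin m) (hker : ∀ i k, σ' i = σ' k → σ i = σ k)
    (ih : ∀ k < j, (σ k : ℕ) = σ' k) : (σ j : ℕ) ≤ σ' j := by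
  by_contra! hlt
  obtain ⟨k, hk, e⟩ := h.exists_lt j _ hlt
  rw [ih k hk] at e
  have := hker k j (Fin.ext e)
  rw [← ih k hk, this] at e
  omega

lemma IsCanonical.val_eq {σ : Fin m → Fin r} {σ' : Fin m → Fin r'} (h : IsCanonical σ)
    (h' : IsCanonical σ') (hker : ∀ i k, σ i = σ k ↔ σ' i = σ' k) (j : Fin m) :
    (σ j : ℕ) = σ' j := by
  induction j using WellFoundedLT.induction with
  | ind j ih =>
    exact le_antisymm (h.val_le j (fun i k => (hker i k).2) ih)
      (h'.val_le j (fun i k => (hker i k).1) (fun k hk => (ih k hk).symm))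

lemma IsCanonical.card_eq {σ : Fin m → Fin r} {σ' : Fin m → Fin r'} (h : IsCanonical σ)
    (h' : IsCanonical σ') (hker : ∀ i k, σ i = σ k ↔ σ' i = σ' k) : r ≤ r' := by
  by_contra! hlt
  obtain ⟨j, hj⟩ := h.1 ⟨r', hlt⟩
  have := h.val_eq h' hker j
  rw [hj] at this
  exact absurd (σ' j).2 (by simp [← this])

lemma exists_canonical {α : Type*} (f : Fin m → α) :
    ∃ (r : ℕ) (σ : Fin m → Fin r) (ι : Fin r ↪ α), IsCanonical σ ∧ ι ∘ σ = f := by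
  classical
  let S : Fin m → Finset (Fin m) := fun i => Finset.univ.filter fun k => f k = f i
  have hS : ∀ i, (S i).Nonempty := fun i => ⟨i, by simp [S]⟩
  let first : Fin m → Fin m := fun i => (S i).min' (hS i)
  have hf : ∀ i, f (first i) = f i := fun i => by
    have := (S i).min'_mem (hS i)
    simpa [S] using this
  have hle : ∀ i, first i ≤ i := fun i => Finset.min'_le _ _ (by simp [S])
  have hcongr : ∀ i k, f i = f k → first i = first k := fun i k h => by
    simp only [first, S, h]
  have hff : ∀ i, first (first i) = first i := fun i => hcongr _ _ (hf i)
  let F : Finset (Fin m) := Finset.univ.filter fun k => first k = k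
  have hF : ∀ i, first i ∈ F := fun i => by simp [F, hff]
  let e := F.orderIsoOfFin rfl
  have he : ∀ k, first (e k).1 = (e k).1 := fun k =>
    (Finset.mem_filter.1 (e k).2).2
  let σ : Fin m → Fin F.card := fun i => e.symm ⟨first i, hF i⟩
  have hσ : ∀ k, σ (e k).1 = k := fun k => by
    have : (⟨first (e k).1, hF _⟩ : F) = e k := Subtype.ext (he k)
    simp only [σ]
    rw [this, OrderIso.symm_apply_apply]
  refine ⟨F.card, σ, ⟨fun k => f (e k).1, fun k k' h => ?_⟩, ⟨fun k => ⟨_, hσ k⟩, fun j => ?_⟩, ?_⟩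
  · have := hcongr _ _ h
    rw [he, he] at this
    exact e.injective (Subtype.ext this)
  · by_cases h0 : (σ j : ℕ) = 0
    · exact Or.inl h0
    · right
      let v : Fin F.card := ⟨σ j - 1, by omega⟩
      refine ⟨(e v).1, lt_of_lt_of_le ?_ (hle j), ?_⟩
      · have : e v < e (σ j) := e.strictMono (Fin.lt_def.2 (by simp only [v]; omega))
        simp only [σ, OrderIso.apply_symm_apply] at this
        exact this
      · rw [hσ]; simp only [v]; omega
  · funext i
    change f (e (e.symm ⟨first i, hF i⟩)).1 = f i
    rw [OrderIso.apply_symm_apply]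
    exact hf i

open scoped Classical in
/-- Every function factors uniquely as a canonical surjection followed by an embedding. -/
theorem sum_eq_sum_canonical {α M : Type*} [Fintype α] [AddCommMonoid M] (Φ : (Fin m → α) → M) :
    ∑ f, Φ f = ∑ r ∈ Finset.range (m + 1), ∑ σ ∈ Finset.univ.filter (IsCanonical (m := m) (r := r)),
      ∑ ι : Fin r ↪ α, Φ (ι ∘ σ) := by
  simp only [Finset.sum_sigma']
  symm
  refine Finset.sum_bij (fun p _ => p.2.2 ∘ p.2.1) (fun _ _ => Finset.mem_univ _) ?_ ?_
    (fun _ _ => rfl)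
  · rintro ⟨r, σ, ι⟩ h ⟨r', σ', ι'⟩ h' heq
    simp only [Finset.mem_sigma, Finset.mem_filter, Finset.mem_univ, true_and, and_true] at h h'
    dsimp only at heq ι ι'
    have hker : ∀ i k, σ i = σ k ↔ σ' i = σ' k := by
      intro i k
      rw [← ι.injective.eq_iff, ← ι'.injective.eq_iff]
      have e := congrFun heq
      simp only [Function.comp] at e
      rw [e, e]
    obtain rfl : r = r' := le_antisymm (h.2.card_eq h'.2 hker)
      (h'.2.card_eq h.2 fun i k => (hker i k).symm)
    obtain rfl : σ = σ' := funext fun j => Fin.ext (h.2.val_eq h'.2 hker j)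
    obtain rfl : ι = ι' := DFunLike.coe_injective (h.2.1.injective_comp_right heq)
    rfl
  · intro f _
    obtain ⟨r, σ, ι, h, e⟩ := exists_canonical f
    refine ⟨⟨r, σ, ι⟩, ?_, e⟩
    have := Fintype.card_le_of_surjective σ h.1
    simp only [Fintype.card_fin] at this
    simp only [Finset.mem_sigma, Finset.mem_filter, Finset.mem_univ, true_and, and_true,
      Finset.mem_range]
    exact ⟨by omega, h⟩

end CanonicalSurjection

namespace LaurentAlg

open CanonicalSurjection

variable {N m r : ℕ}

lemma vand_eq_sum : vand N = ∑ π : Equiv.Perm (Fin N),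
    AddMonoidAlgebra.single (fun l => ((π l : ℕ) : ℤ)) ((Equiv.Perm.sign π : ℤ) : ℝ) := by
  rw [vand, ← Matrix.det_transpose, Matrix.det_apply']
  refine Finset.sum_congr rfl fun π _ => ?_
  have h : ∏ i, (Matrix.vandermonde fun j => (X j 1 : LaurentAlg N)).transpose (π i) i =
      AddMonoidAlgebra.single (fun l => ((π l : ℕ) : ℤ)) 1 := by
    simp only [Matrix.transpose_apply, Matrix.vandermonde_apply, X_pow, mul_one]
    simp only [X, AddMonoidAlgebra.prod_single, Finset.prod_const_one]
    congr 1
    exact Finset.univ_sum_single fun l => ((π l : ℕ) : ℤ)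
  rw [h, AddMonoidAlgebra.intCast_def, AddMonoidAlgebra.single_mul_single]
  simp

lemma CT_single_mul_weyl (E : Fin N → ℤ) :
    CT (AddMonoidAlgebra.single E 1 * weyl N) = ∑ π : Equiv.Perm (Fin N), ∑ θ : Equiv.Perm (Fin N),
      if ∀ l, E l + (π l : ℕ) = (π (θ l) : ℕ) then ((Equiv.Perm.sign θ : ℤ) : ℝ) else 0 := by
  rw [weyl, vand_eq_sum, map_sum, Finset.sum_mul_sum, Finset.mul_sum, map_sum]
  refine Finset.sum_congr rfl fun π _ => ?_
  rw [Finset.mul_sum, map_sum, ← Equiv.sum_comp (Equiv.mulLeft π)]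
  refine Finset.sum_congr rfl fun θ _ => ?_
  rw [inv_single, AddMonoidAlgebra.single_mul_single, AddMonoidAlgebra.single_mul_single, CT_single]
  have hs : (1 : ℝ) * (((Equiv.Perm.sign π : ℤ) : ℝ) *
      ((Equiv.Perm.sign (Equiv.mulLeft π θ) : ℤ) : ℝ)) = ((Equiv.Perm.sign θ : ℤ) : ℝ) := by
    rw [one_mul, Equiv.coe_mulLeft, Equiv.Perm.sign_mul, ← Int.cast_mul, ← Units.val_mul, ← mul_assoc,
      Int.units_mul_self, one_mul]
  rw [hs]
  refine if_congr ?_ rfl rfl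
  rw [funext_iff]
  refine forall_congr' fun l => ?_
  simp only [Pi.add_apply, Pi.neg_apply, Pi.zero_apply, Equiv.coe_mulLeft, Equiv.Perm.mul_apply]
  omega

lemma psumProd_ofFn (n : Fin m → ℤ) : (psumProd (List.ofFn n) : LaurentAlg N) =
    ∑ f : Fin m → Fin N, AddMonoidAlgebra.single (∑ i, Pi.single (f i) (n i)) 1 := by
  rw [psumProd, List.map_ofFn, List.prod_ofFn]
  simp only [Function.comp, psum]
  rw [Finset.prod_univ_sum, Fintype.piFinset_univ]
  refine Finset.sum_congr rfl fun f _ => ?_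
  simp only [X, AddMonoidAlgebra.prod_single, Finset.prod_const_one]

/-- The total exponent carried by a block of `σ`. -/
def blockSum (n : Fin m → ℤ) (σ : Fin m → Fin r) (k : Fin r) : ℤ :=
  ∑ j with σ j = k, n j

lemma exponent_apply_image (n : Fin m → ℤ) (σ : Fin m → Fin r) (ι : Fin r ↪ Fin N) (k : Fin r) :
    (∑ i, Pi.single ((ι ∘ σ) i) (n i) : Fin N → ℤ) (ι k) = blockSum n σ k := by
  rw [Finset.sum_apply, blockSum, Finset.sum_filter]
  refine Finset.sum_congr rfl fun i _ => ?_
  simp [Pi.single_apply, ι.injective.eq_iff, eq_comm]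

lemma exponent_apply_of_notMem (n : Fin m → ℤ) (σ : Fin m → Fin r) (ι : Fin r ↪ Fin N) {l : Fin N}
    (hl : l ∉ Set.range ι) : (∑ i, Pi.single ((ι ∘ σ) i) (n i) : Fin N → ℤ) l = 0 := by
  rw [Finset.sum_apply]
  refine Finset.sum_eq_zero fun i _ => ?_
  rw [Pi.single_apply, if_neg]
  rintro rfl
  exact hl ⟨_, rfl⟩

/-- The matrix of coincidences `M_k + a_k = a_i`. -/
def coincidence (M : Fin r → ℤ) (a : Fin r → Fin N) : Matrix (Fin r) (Fin r) ℝ :=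
  Matrix.of fun i k => if M k + (a k : ℕ) = (a i : ℕ) then 1 else 0

lemma det_coincidence (M : Fin r → ℤ) (a : Fin r → Fin N) : (coincidence M a).det =
    ∑ ρ : Equiv.Perm (Fin r), if ∀ k, M k + (a k : ℕ) = (a (ρ k) : ℕ) then
      ((Equiv.Perm.sign ρ : ℤ) : ℝ) else 0 := by
  rw [Matrix.det_apply']
  refine Finset.sum_congr rfl fun ρ _ => ?_
  simp only [coincidence, Matrix.of_apply, Finset.prod_ite_zero, Finset.prod_const_one,
    Finset.mem_univ, true_imp_iff, mul_ite, mul_one, mul_zero]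

lemma exists_viaFintypeEmbedding {ι : Fin r ↪ Fin N} {θ : Equiv.Perm (Fin N)}
    (h : ∀ l ∉ Set.range ι, θ l = l) : ∃ ρ : Equiv.Perm (Fin r), ρ.viaFintypeEmbedding ι = θ := by
  have : ∀ k, ∃ k', ι k' = θ (ι k) := by
    intro k
    by_contra hk
    have := θ.injective (h (θ (ι k)) hk)
    exact hk ⟨k, this.symm⟩
  choose ρ hρ using this
  have hinj : Function.Injective ρ := fun k k' e => by
    apply ι.injective
    apply θ.injective
    rw [← hρ, ← hρ, e]
  refine ⟨Equiv.ofBijective ρ (Finite.injective_iff_bijective.1 hinj), Equiv.ext fun l => ?_⟩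
  by_cases hl : l ∈ Set.range ι
  · obtain ⟨k, rfl⟩ := hl
    rw [Equiv.Perm.viaFintypeEmbedding_apply_image]
    exact hρ k
  · rw [Equiv.Perm.viaFintypeEmbedding_apply_notMem_range _ _ hl, h l hl]

lemma sum_perm_eq_det (n : Fin m → ℤ) (σ : Fin m → Fin r) (ι : Fin r ↪ Fin N)
    (π : Equiv.Perm (Fin N)) :
    (∑ θ : Equiv.Perm (Fin N), if ∀ l, (∑ i, Pi.single ((ι ∘ σ) i) (n i) : Fin N → ℤ) l +
      (π l : ℕ) = (π (θ l) : ℕ) then ((Equiv.Perm.sign θ : ℤ) : ℝ) else 0) =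
    (coincidence (blockSum n σ) (π ∘ ι)).det := by
  rw [det_coincidence]
  symm
  refine Finset.sum_of_injOn (fun ρ => ρ.viaFintypeEmbedding ι) ?_ (fun _ _ => Finset.mem_univ _)
    ?_ ?_
  · intro ρ _ ρ' _ h
    refine Equiv.ext fun k => ι.injective ?_
    rw [← Equiv.Perm.viaFintypeEmbedding_apply_image, ← Equiv.Perm.viaFintypeEmbedding_apply_image]
    exact congrFun (congrArg DFunLike.coe h) _
  · intro θ _ hθ
    refine if_neg fun hall => hθ ?_
    obtain ⟨ρ, hρ⟩ := exists_viaFintypeEmbedding (ι := ι) (θ := θ) fun l hl => by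
      have := hall l
      rw [exponent_apply_of_notMem n σ ι hl, zero_add, Nat.cast_inj] at this
      exact (π.injective (Fin.ext this)).symm
    exact ⟨ρ, Finset.mem_coe.2 (Finset.mem_univ _), hρ⟩
  · intro ρ _
    rw [Equiv.Perm.viaFintypeEmbedding_sign]
    refine if_congr ⟨fun h l => ?_, fun h k => ?_⟩ rfl rfl
    · by_cases hl : l ∈ Set.range ι
      · obtain ⟨k, rfl⟩ := hl
        rw [exponent_apply_image, Equiv.Perm.viaFintypeEmbedding_apply_image]
        exact h k
      · rw [exponent_apply_of_notMem n σ ι hl,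
          Equiv.Perm.viaFintypeEmbedding_apply_notMem_range _ _ hl, zero_add]
    · have := h (ι k)
      rwa [exponent_apply_image, Equiv.Perm.viaFintypeEmbedding_apply_image] at this

lemma sum_embedding_eq_sum (M : Fin r → ℤ) :
    ∑ ι : Fin r ↪ Fin N, (coincidence M ι).det = ∑ a : Fin r → Fin N, (coincidence M a).det := by
  refine Finset.sum_of_injOn (fun ι => ⇑ι) (DFunLike.coe_injective.injOn)
    (fun _ _ => Finset.mem_coe.2 (Finset.mem_univ _)) ?_ (fun _ _ => rfl)
  intro a _ ha
  have : ¬ Function.Injective a := fun h => ha ⟨⟨a, h⟩, by simp, rfl⟩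
  simp only [Function.Injective, not_forall] at this
  obtain ⟨i, k, hik, hne⟩ := this
  refine Matrix.det_zero_of_row_eq hne ?_
  funext l
  simp [coincidence, hik]

open scoped Classical in
/-- Power-sum moments against the Weyl density, as determinants of coincidences. -/
theorem CT_psumProd_mul_weyl (n : Fin m → ℤ) :
    CT (psumProd (List.ofFn n) * weyl N) = (N.factorial : ℝ) * ∑ r ∈ Finset.range (m + 1),
      ∑ σ ∈ Finset.univ.filter (IsCanonical (m := m) (r := r)),
        ∑ a : Fin r → Fin N, (coincidence (blockSum n σ) a).det := by
  rw [psumProd_ofFn, Finset.sum_mul, map_sum, sum_eq_sum_canonical, Finset.mul_sum]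
  refine Finset.sum_congr rfl fun r _ => ?_
  rw [Finset.mul_sum]
  refine Finset.sum_congr rfl fun σ _ => ?_
  simp only [CT_single_mul_weyl, sum_perm_eq_det]
  rw [Finset.sum_comm]
  have (π : Equiv.Perm (Fin N)) : ∑ ι : Fin r ↪ Fin N, (coincidence (blockSum n σ) (π ∘ ι)).det =
      ∑ a : Fin r → Fin N, (coincidence (blockSum n σ) a).det := by
    rw [← sum_embedding_eq_sum]
    exact Fintype.sum_equiv (Equiv.embeddingCongr (Equiv.refl _) π) _ _ fun ι => rfl
  simp only [this, Finset.sum_const, Finset.card_univ, Fintype.card_perm, Fintype.card_fin,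
    nsmul_eq_mul]

lemma CT_weyl : CT (weyl N) = N.factorial := by
  have := CT_psumProd_mul_weyl (N := N) (fun i : Fin 0 => i.elim0)
  have h : IsCanonical (default : Fin 0 → Fin 0) := ⟨fun k => k.elim0, fun j => j.elim0⟩
  simpa [h, Finset.filter_singleton] using this

end LaurentAlg

/-- The additive character `t ↦ e^{2πit}`. -/
noncomputable def expChar (t : ℝ) : ℂ := Complex.exp (t * (2 * Real.pi * Complex.I))

lemma expChar_zero : expChar 0 = 1 := by simp [expChar]

lemma expChar_add (s t : ℝ) : expChar (s + t) = expChar s * expChar t := by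
  simp only [expChar, Complex.ofReal_add, add_mul, Complex.exp_add]

lemma expChar_sum {ι : Type*} (s : Finset ι) (t : ι → ℝ) :
    expChar (∑ i ∈ s, t i) = ∏ i ∈ s, expChar (t i) := by
  simp only [expChar, Complex.ofReal_sum, Finset.sum_mul, Complex.exp_sum]

lemma expChar_int (k : ℤ) : expChar k = 1 := by
  simp [expChar, Complex.exp_int_mul_two_pi_mul_I]

lemma norm_expChar (t : ℝ) : ‖expChar t‖ = 1 := by
  have : (t * (2 * Real.pi * Complex.I) : ℂ) = ((t * (2 * Real.pi) : ℝ) : ℂ) * Complex.I := by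
    push_cast; ring
  rw [expChar, this, Complex.norm_exp_ofReal_mul_I]

lemma continuous_expChar : Continuous expChar := by
  unfold expChar; fun_prop

/-- The interval `(-N/2, N/2]`, a period of the rescaled spectrum. -/
def period (N : ℕ) : Set ℝ := Set.Ioc (-(N / 2 : ℝ)) (N / 2)

/-- Lebesgue measure on `(-N/2, N/2]^r`. -/
noncomputable def boxMeasure (N r : ℕ) : Measure (Fin r → ℝ) :=
  Measure.pi fun _ => (volume : Measure ℝ).restrict (period N)

instance (N : ℕ) : IsFiniteMeasure ((volume : Measure ℝ).restrict (period N)) :=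
  ⟨by simp [period]⟩

instance (N r : ℕ) : IsFiniteMeasure (boxMeasure N r) := by
  unfold boxMeasure; infer_instance

lemma integral_period_expChar {N : ℕ} (hN : 1 ≤ N) (k : ℤ) :
    ∫ x in period N, (1 / N : ℂ) * expChar (x * k / N) = if k = 0 then 1 else 0 := by
  have hN0 : (N : ℝ) ≠ 0 := by positivity
  have hN0' : (N : ℂ) ≠ 0 := by exact_mod_cast hN0
  rw [period, ← intervalIntegral.integral_of_le (by linarith [(Nat.cast_nonneg N : (0 : ℝ) ≤ N)])]
  split_ifs with hk
  · simp [hk, expChar_zero]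
    field_simp
  · have hc : (2 * Real.pi * Complex.I * k / N : ℂ) ≠ 0 := by
      have : (k : ℂ) ≠ 0 := by exact_mod_cast hk
      have := Complex.two_pi_I_ne_zero
      positivity
    have he (x : ℝ) : expChar (x * k / N) = Complex.exp ((2 * Real.pi * Complex.I * k / N : ℂ) * x) := by
      rw [expChar]; congr 1; push_cast; ring
    have hshift : expChar ((N / 2 : ℝ) * k / N) = expChar ((-(N / 2 : ℝ)) * k / N) := by
      have : (N / 2 : ℝ) * k / N = (-(N / 2 : ℝ)) * k / N + k := by field_simp; ring
      rw [this, expChar_add, expChar_int, mul_one]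
    rw [intervalIntegral.integral_const_mul]
    simp only [he] at hshift ⊢
    rw [integral_exp_mul_complex hc, hshift, sub_self, zero_div, mul_zero]

/-- The Dirichlet kernel of the rescaled eigenvalue process. -/
noncomputable def dirichletK (N : ℕ) (x y : ℝ) : ℂ :=
  ∑ a : Fin N, (1 / N : ℂ) * expChar ((a : ℕ) * (x - y) / N)

/-- The `r`-point function of the rescaled eigenvalue process. -/
noncomputable def dirichletDet (N : ℕ) {r : ℕ} (x : Fin r → ℝ) : ℂ :=
  (Matrix.of fun i k : Fin r => dirichletK N (x i) (x k)).det

lemma continuous_dirichletK (N : ℕ) : Continuous fun p : ℝ × ℝ => dirichletK N p.1 p.2 := by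
  unfold dirichletK
  have := continuous_expChar
  fun_prop

lemma continuous_dirichletDet (N r : ℕ) : Continuous (dirichletDet N : (Fin r → ℝ) → ℂ) := by
  change Continuous fun x : Fin r → ℝ => (Matrix.of fun i k => dirichletK N (x i) (x k)).det
  have h (i k : Fin r) : Continuous fun x : Fin r → ℝ => dirichletK N (x i) (x k) :=
    (continuous_dirichletK N).comp (f := fun x : Fin r → ℝ => (x i, x k)) (by fun_prop)
  exact Continuous.matrix_det (continuous_matrix h)

lemma norm_dirichletK_le (N : ℕ) (x y : ℝ) : ‖dirichletK N x y‖ ≤ 1 := by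
  refine (norm_sum_le _ _).trans ?_
  simp only [norm_mul, norm_expChar, mul_one, Finset.sum_const, Finset.card_univ, Fintype.card_fin,
    nsmul_eq_mul, norm_div, norm_one, Complex.norm_natCast]
  rw [mul_one_div]
  exact div_self_le_one _

lemma norm_dirichletDet_le (N : ℕ) {r : ℕ} (x : Fin r → ℝ) : ‖dirichletDet N x‖ ≤ r.factorial := by
  rw [dirichletDet, Matrix.det_apply]
  refine (norm_sum_le _ _).trans ?_
  have (ρ : Equiv.Perm (Fin r)) : ‖Equiv.Perm.sign ρ • ∏ i, Matrix.of
      (fun i k : Fin r => dirichletK N (x i) (x k)) (ρ i) i‖ ≤ 1 := by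
    rw [Units.smul_def, norm_smul, Int.norm_coe_units, one_mul, norm_prod]
    exact Finset.prod_le_one (fun _ _ => norm_nonneg _) fun _ _ => norm_dirichletK_le _ _ _
  refine (Finset.sum_le_card_nsmul _ _ 1 fun ρ _ => this ρ).trans ?_
  simp [Fintype.card_perm]

open LaurentAlg in
lemma sum_det_coincidence {N r : ℕ} (hN : 1 ≤ N) (M : Fin r → ℤ) :
    ((∑ a : Fin r → Fin N, (coincidence M a).det : ℝ) : ℂ) =
      ∫ x, (∏ k, expChar (x k * M k / N)) * dirichletDet N x ∂boxMeasure N r := by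
  have hterm (a : Fin r → Fin N) (ρ : Equiv.Perm (Fin r)) :
      (((if ∀ k, M k + (a k : ℕ) = (a (ρ k) : ℕ) then ((Equiv.Perm.sign ρ : ℤ) : ℝ) else 0) : ℝ) : ℂ)
      = ∫ x, ((Equiv.Perm.sign ρ : ℤ) : ℂ) * ∏ k, ((1 / N : ℂ) *
        expChar (x k * (M k + (a k : ℕ) - (a (ρ k) : ℕ) : ℤ) / N)) ∂boxMeasure N r := by
    rw [boxMeasure, integral_const_mul, integral_fintype_prod_eq_prod (fun k (x : ℝ) =>
      ((1 / N : ℂ) * expChar (x * (M k + (a k : ℕ) - (a (ρ k) : ℕ) : ℤ) / N)))]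
    simp only [integral_period_expChar hN, Finset.prod_ite_zero, Finset.prod_const_one,
      Finset.mem_univ, true_imp_iff, mul_ite, mul_one, mul_zero, sub_eq_zero]
    split_ifs <;> simp
  have h_int (a : Fin r → Fin N) (ρ : Equiv.Perm (Fin r)) :
      Integrable (fun x : Fin r → ℝ => ((Equiv.Perm.sign ρ : ℤ) : ℂ) * ∏ k, ((1 / N : ℂ) *
        expChar (x k * (M k + (a k : ℕ) - (a (ρ k) : ℕ) : ℤ) / N))) (boxMeasure N r) := by
    refine Integrable.of_bound (C := ∏ k : Fin r, ‖(1 / N : ℂ)‖) ?_ (Eventually.of_forall fun x => ?_)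
    · have := continuous_expChar
      exact Continuous.aestronglyMeasurable (by fun_prop)
    · rw [norm_mul, norm_prod]
      simp only [norm_mul, norm_expChar, mul_one]
      rw [Complex.norm_intCast, ← Int.cast_abs, Int.isUnit_iff_abs_eq.1 (Units.isUnit _)]
      simp
  simp only [det_coincidence, Complex.ofReal_sum, hterm]
  rw [Finset.sum_comm]
  simp_rw [← integral_finsetSum Finset.univ fun a _ => h_int a _]
  rw [← integral_finsetSum Finset.univ fun ρ _ => integrable_finsetSum _ fun a _ => h_int a ρ]
  refine integral_congr_ae (Eventually.of_forall fun x => ?_)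
  dsimp only
  rw [dirichletDet, Matrix.det_apply', Finset.mul_sum]
  refine Finset.sum_congr rfl fun ρ _ => ?_
  rw [← Finset.mul_sum, mul_left_comm]
  congr 1
  have hsplit (a : Fin r → Fin N) : ∏ k, ((1 / N : ℂ) *
      expChar (x k * (M k + (a k : ℕ) - (a (ρ k) : ℕ) : ℤ) / N)) =
      (∏ k, expChar (x k * M k / N)) * ∏ k, ((1 / N : ℂ) *
        expChar ((a (ρ k) : ℕ) * (x (ρ k) - x k) / N)) := by
    have h1 (k : Fin r) : (1 / N : ℂ) *
        expChar (x k * (M k + (a k : ℕ) - (a (ρ k) : ℕ) : ℤ) / N) =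
        (expChar (x k * M k / N) * (1 / N : ℂ)) * (expChar ((a k : ℕ) * x k / N) *
          expChar (- ((a (ρ k) : ℕ) * x k / N))) := by
      rw [mul_comm _ (1 / N : ℂ), mul_assoc, ← expChar_add, ← expChar_add]
      congr 2; push_cast; ring
    have h2 (k : Fin r) : (1 / N : ℂ) * expChar ((a (ρ k) : ℕ) * (x (ρ k) - x k) / N) =
        (1 / N : ℂ) * (expChar ((a (ρ k) : ℕ) * x (ρ k) / N) *
          expChar (- ((a (ρ k) : ℕ) * x k / N))) := by
      rw [← expChar_add]
      congr 2; ring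
    simp only [h1, h2, Finset.prod_mul_distrib]
    rw [Equiv.prod_comp ρ fun k => expChar ((a k : ℕ) * x k / N)]
    ring
  simp only [hsplit, ← Finset.mul_sum]
  congr 1
  simp only [Matrix.of_apply, dirichletK]
  rw [Finset.prod_univ_sum, Fintype.piFinset_univ,
    ← Equiv.sum_comp (Equiv.arrowCongr ρ (Equiv.refl (Fin N)))]
  refine Finset.sum_congr rfl fun a _ => Finset.prod_congr rfl fun k _ => ?_
  simp

open scoped Classical in
open LaurentAlg UnitaryMoments CanonicalSurjection in
/-- Moments of traces as integrals against the correlation functions. -/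
theorem integral_prod_tr {N m : ℕ} (hN : 1 ≤ N) (μ : Measure (Matrix.unitaryGroup (Fin N) ℂ))
    [IsProbabilityMeasure μ] [μ.IsMulLeftInvariant] (n : Fin m → ℤ) :
    ∫ U, ∏ i, tr (n i) U ∂μ = ∑ r ∈ Finset.range (m + 1),
      ∑ σ ∈ Finset.univ.filter (IsCanonical (m := m) (r := r)),
        ∫ x, (∏ i, expChar (x (σ i) * n i / N)) * dirichletDet N x ∂boxMeasure N r := by
  have h := weyl_integration μ (List.ofFn n)
  rw [CT_psumProd_mul_weyl, CT_weyl, Complex.ofReal_mul, mul_comm] at h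
  have h := mul_left_cancel₀ (by simp [Nat.factorial_ne_zero]) h
  have htr : (fun U => trProd (List.ofFn n) U) = fun U : Matrix.unitaryGroup (Fin N) ℂ =>
      ∏ i, tr (n i) U := by
    funext U
    rw [trProd, List.map_ofFn, List.prod_ofFn]
    rfl
  rw [htr] at h
  rw [h, Complex.ofReal_sum]
  refine Finset.sum_congr rfl fun r _ => ?_
  rw [Complex.ofReal_sum]
  refine Finset.sum_congr rfl fun σ _ => ?_
  rw [sum_det_coincidence hN]
  refine integral_congr_ae (Eventually.of_forall fun x => ?_)
  dsimp only
  congr 1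
  rw [← Finset.prod_fiberwise (Finset.univ : Finset (Fin m)) σ]
  refine Finset.prod_congr rfl fun k _ => ?_
  rw [blockSum, Int.cast_sum, Finset.mul_sum, Finset.sum_div, expChar_sum]
  refine Finset.prod_congr rfl fun i hi => ?_
  rw [(Finset.mem_filter.1 hi).2]

namespace UnitaryMoments

open CanonicalSurjection

variable {N m : ℕ}

lemma norm_tr_le (n : ℤ) (U : Matrix.unitaryGroup (Fin N) ℂ) : ‖tr n U‖ ≤ N := by
  rw [tr, Matrix.trace]
  refine (norm_sum_le _ _).trans ?_
  refine (Finset.sum_le_card_nsmul _ _ 1 fun i _ => entry_norm_bound_of_unitary (U ^ n).2 i i).trans ?_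
  simp

open scoped Classical in
lemma integral_pow_finset (hN : 1 ≤ N) (μ : Measure (Matrix.unitaryGroup (Fin N) ℂ))
    [IsProbabilityMeasure μ] [μ.IsMulLeftInvariant] (c : ℤ → ℂ) (s : Finset ℤ) :
    ∫ U, (∑ n ∈ s, c n * tr n U) ^ m ∂μ = ∑ r ∈ Finset.range (m + 1),
      ∑ σ ∈ Finset.univ.filter (IsCanonical (m := m) (r := r)),
        ∫ x, (∏ i, ∑ n ∈ s, c n * expChar (x (σ i) * n / N)) * dirichletDet N x ∂boxMeasure N r := by
  have hexp (U : Matrix.unitaryGroup (Fin N) ℂ) : (∑ n ∈ s, c n * tr n U) ^ m =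
      ∑ n ∈ Fintype.piFinset fun _ : Fin m => s, (∏ i, c (n i)) * ∏ i, tr (n i) U := by
    rw [← Fin.prod_const, Finset.prod_univ_sum]
    simp only [Finset.prod_mul_distrib]
  have h_int (n : Fin m → ℤ) : Integrable
      (fun U : Matrix.unitaryGroup (Fin N) ℂ => (∏ i, c (n i)) * ∏ i, tr (n i) U) μ := by
    refine integrable_of_continuous ?_
    exact continuous_const.mul (continuous_finsetProd _ fun i _ => continuous_tr (n i))
  have h_int' {r : ℕ} (σ : Fin m → Fin r) (n : Fin m → ℤ) : Integrable (fun x : Fin r → ℝ =>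
      (∏ i, c (n i)) * ((∏ i, expChar (x (σ i) * n i / N)) * dirichletDet N x))
      (boxMeasure N r) := by
    refine Integrable.of_bound (C := ‖∏ i, c (n i)‖ * r.factorial) ?_
      (Eventually.of_forall fun x => ?_)
    · have := continuous_expChar
      have := continuous_dirichletDet N r
      exact Continuous.aestronglyMeasurable (by fun_prop)
    · rw [norm_mul, norm_mul, norm_prod Finset.univ fun i => expChar _]
      simp only [norm_expChar, Finset.prod_const_one, one_mul]
      exact mul_le_mul_of_nonneg_left (norm_dirichletDet_le N x) (norm_nonneg _)
  simp only [hexp]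
  rw [integral_finsetSum _ fun n _ => h_int n]
  simp only [integral_const_mul, integral_prod_tr hN, Finset.mul_sum]
  rw [Finset.sum_comm]
  refine Finset.sum_congr rfl fun r _ => ?_
  rw [Finset.sum_comm]
  refine Finset.sum_congr rfl fun σ _ => ?_
  simp only [← integral_const_mul]
  rw [← integral_finsetSum _ fun n _ => h_int' σ n]
  refine integral_congr_ae (Eventually.of_forall fun x => ?_)
  dsimp only
  rw [Finset.prod_univ_sum, Finset.sum_mul]
  simp only [Finset.prod_mul_distrib, mul_assoc]

open scoped Classical in
/-- Moments of a linear statistic, as integrals against the correlation functions. -/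
theorem integral_tsum_pow (hN : 1 ≤ N) (μ : Measure (Matrix.unitaryGroup (Fin N) ℂ))
    [IsProbabilityMeasure μ] [μ.IsMulLeftInvariant] (c : ℤ → ℂ) (hc : Summable fun n => ‖c n‖) :
    ∫ U, (∑' n, c n * tr n U) ^ m ∂μ = ∑ r ∈ Finset.range (m + 1),
      ∑ σ ∈ Finset.univ.filter (IsCanonical (m := m) (r := r)),
        ∫ x, (∏ i, ∑' n : ℤ, c n * expChar (x (σ i) * n / N)) * dirichletDet N x
          ∂boxMeasure N r := by
  have hbound {B : ℝ} {b : ℤ → ℂ} (hb : ∀ n, ‖b n‖ ≤ B) (hB : 0 ≤ B) (s : Finset ℤ) :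
      ‖∑ n ∈ s, c n * b n‖ ≤ (∑' n, ‖c n‖) * B := by
    refine (norm_sum_le _ _).trans ?_
    calc ∑ n ∈ s, ‖c n * b n‖ ≤ ∑ n ∈ s, ‖c n‖ * B := Finset.sum_le_sum fun n _ => by
          rw [norm_mul]; exact mul_le_mul_of_nonneg_left (hb n) (norm_nonneg _)
      _ ≤ (∑' n, ‖c n‖) * B := by
          rw [← Finset.sum_mul]
          exact mul_le_mul_of_nonneg_right (hc.sum_le_tsum _ fun _ _ => norm_nonneg _) hB
  have hsum {B : ℝ} {b : ℤ → ℂ} (hb : ∀ n, ‖b n‖ ≤ B) :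
      Tendsto (fun s : Finset ℤ => ∑ n ∈ s, c n * b n) atTop (nhds (∑' n, c n * b n)) := by
    refine (Summable.of_norm_bounded (hc.mul_right B) fun n => ?_).hasSum
    rw [norm_mul]; exact mul_le_mul_of_nonneg_left (hb n) (norm_nonneg _)
  have hL : Tendsto (fun s : Finset ℤ => ∫ U, (∑ n ∈ s, c n * tr n U) ^ m ∂μ) atTop
      (nhds (∫ U, (∑' n, c n * tr n U) ^ m ∂μ)) := by
    refine tendsto_integral_filter_of_dominated_convergence
      (fun _ => ((∑' n, ‖c n‖) * N) ^ m) (Eventually.of_forall fun s => ?_)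
      (Eventually.of_forall fun s => Eventually.of_forall fun U => ?_) (integrable_const _)
      (Eventually.of_forall fun U => ?_)
    · refine (integrable_of_continuous (μ := μ) ?_).aestronglyMeasurable
      exact (continuous_finsetSum _ fun n _ => continuous_const.mul (continuous_tr n)).pow m
    · rw [norm_pow]
      exact pow_le_pow_left₀ (norm_nonneg _)
        (hbound (fun n => norm_tr_le n U) (Nat.cast_nonneg N) s) m
    · exact (hsum fun n => norm_tr_le n U).pow m
  refine tendsto_nhds_unique hL ?_
  simp only [integral_pow_finset hN]
  refine tendsto_finsetSum _ fun r _ => tendsto_finsetSum _ fun σ _ => ?_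
  refine tendsto_integral_filter_of_dominated_convergence
    (fun _ => (∏ _i : Fin m, (∑' n, ‖c n‖) * 1) * r.factorial) (Eventually.of_forall fun s => ?_)
    (Eventually.of_forall fun s => Eventually.of_forall fun x => ?_) (integrable_const _)
    (Eventually.of_forall fun x => ?_)
  · have := continuous_expChar
    have := continuous_dirichletDet N r
    exact Continuous.aestronglyMeasurable (by fun_prop)
  · rw [norm_mul, norm_prod]
    refine mul_le_mul ?_ (norm_dirichletDet_le N x) (norm_nonneg _) ?_
    · exact Finset.prod_le_prod (fun _ _ => norm_nonneg _) fun i _ =>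
        hbound (fun n => (norm_expChar _).le) zero_le_one s
    · exact Finset.prod_nonneg fun _ _ => mul_nonneg (tsum_nonneg fun _ => norm_nonneg _) zero_le_one
  · exact (tendsto_finsetProd _ fun i _ => hsum fun n => (norm_expChar _).le).mul_const _

end UnitaryMoments

lemma isBigO_comp_mul_of_decay {E : Type*} [NormedAddCommGroup E] {h : ℝ → E} {A b s : ℝ}
    (hb : 0 ≤ b) (hs : 0 < s) (hh : ∀ x, ‖h x‖ ≤ A * (1 + |x|) ^ (-b)) (hA : 0 ≤ A) :
    (fun t => h (s * t)) =O[cocompact ℝ] fun t => |t| ^ (-b) := by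
  refine Asymptotics.IsBigO.of_bound (A * s ^ (-b)) ?_
  have h0 : ∀ᶠ t : ℝ in cocompact ℝ, t ≠ 0 := isCompact_singleton.compl_mem_cocompact
  filter_upwards [h0] with t ht
  refine (hh _).trans ?_
  rw [Real.norm_of_nonneg (by positivity), mul_assoc, ← Real.mul_rpow hs.le (abs_nonneg t)]
  refine mul_le_mul_of_nonneg_left ?_ hA
  have := abs_pos.2 ht
  refine Real.rpow_le_rpow_of_nonpos (by positivity) ?_ (by linarith)
  rw [abs_mul, abs_of_pos hs]
  linarith

lemma fourier_comp_mul {g : ℝ → ℂ} {s : ℝ} (hs : 0 < s) (u : ℝ) :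
    FourierTransform.fourier (fun t => g (s * t)) u =
      (1 / s : ℂ) * ∫ x : ℝ, g x * Complex.exp (-(2 * Real.pi * Complex.I) * x * (u / s : ℝ)) := by
  rw [Real.fourier_eq']
  have h := Measure.integral_comp_mul_left
    (fun x : ℝ => g x * Complex.exp (-(2 * Real.pi * Complex.I) * x * (u / s : ℝ))) s
  rw [abs_of_pos (inv_pos.2 hs), Complex.real_smul] at h
  rw [one_div, ← Complex.ofReal_inv, ← h]
  refine integral_congr_ae (Eventually.of_forall fun t => ?_)
  have hs' : (s : ℂ) ≠ 0 := by exact_mod_cast hs.ne'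
  simp only [smul_eq_mul, RCLike.inner_apply, conj_trivial]
  rw [mul_comm]
  congr 2
  push_cast
  field_simp

/-- Poisson summation on the lattice `Nℤ`. -/
theorem tsum_expChar_eq_tsum {N : ℕ} (hN : 1 ≤ N) {f fhat : ℝ → ℝ} (hfcont : Continuous f)
    {A b : ℝ} (hA : 0 ≤ A) (hb : 1 < b) (hf : ∀ x, |f x| ≤ A * (1 + |x|) ^ (-b))
    (hfhat : ∀ u, |fhat u| ≤ A * (1 + |u|) ^ (-b))
    (hfourier : ∀ u : ℝ, (fhat u : ℂ) =
      ∫ x : ℝ, (f x : ℂ) * Complex.exp (-(2 * Real.pi * Complex.I) * x * u)) (x : ℝ) :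
    ∑' n : ℤ, (1 / N : ℂ) * (fhat ((n : ℝ) / N) : ℂ) * expChar (x * n / N) =
      ((∑' k : ℤ, f (x + N * k) : ℝ) : ℂ) := by
  have hN0 : (0 : ℝ) < N := by exact_mod_cast hN
  have hF (u : ℝ) : FourierTransform.fourier (fun t => (f (N * t) : ℂ)) u =
      (1 / N : ℂ) * (fhat (u / N) : ℂ) := by
    rw [fourier_comp_mul (g := fun t => (f t : ℂ)) hN0, ← hfourier, Complex.ofReal_natCast]
  have hO2 : FourierTransform.fourier (fun t => (f (N * t) : ℂ)) =O[cocompact ℝ]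
      fun x => |x| ^ (-b) := by
    have := (isBigO_comp_mul_of_decay (h := fun u => (fhat u : ℂ)) (by linarith) (inv_pos.2 hN0)
      (by simpa using hfhat) hA).const_mul_left (1 / N : ℂ)
    refine this.congr_left fun u => ?_
    rw [hF, ← div_eq_inv_mul]
  have h := Real.tsum_eq_tsum_fourier_of_rpow_decay (f := fun t => (f (N * t) : ℂ)) (by fun_prop) hb
    (isBigO_comp_mul_of_decay (h := fun u => (f u : ℂ)) (by linarith) hN0 (by simpa using hf) hA)
    hO2 (x / N)
  rw [Complex.ofReal_tsum]
  have hl (k : ℤ) : N * (x / N + k) = x + N * k := by field_simp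
  simp only [hl, hF] at h
  rw [h]
  refine tsum_congr fun n => ?_
  rw [fourier_coe_apply, expChar]
  congr 2
  push_cast
  ring

lemma summable_fhat {N : ℕ} (hN : 1 ≤ N) {fhat : ℝ → ℝ} {A b : ℝ} (hA : 0 ≤ A) (hb : 1 < b)
    (hfhat : ∀ u, |fhat u| ≤ A * (1 + |u|) ^ (-b)) :
    Summable fun n : ℤ => ‖(1 / N : ℂ) * (fhat ((n : ℝ) / N) : ℂ)‖ := by
  have hN0 : (0 : ℝ) < N := by exact_mod_cast hN
  have := (isBigO_comp_mul_of_decay (h := fun u => (fhat u : ℂ)) (by linarith) (inv_pos.2 hN0)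
      (by simpa using hfhat) hA).const_mul_left (1 / N : ℂ)
  have h2 := this.comp_tendsto Int.tendsto_coe_cofinite
  refine (summable_of_isBigO (Real.summable_abs_int_rpow hb) h2).norm.congr fun n => ?_
  simp [div_eq_inv_mul]

section Periodization

variable {f : ℝ → ℝ} {A b : ℝ}

lemma decay_shift_le (hA : 0 ≤ A) (hb : 1 < b) (hf : ∀ x, |f x| ≤ A * (1 + |x|) ^ (-b)) {N : ℕ}
    {x : ℝ} (hx : |x| ≤ N / 2) {k : ℤ} (hk : k ≠ 0) {y : ℝ} (hy : 0 < y)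
    (hyk : y ≤ N * |(k : ℝ)| / 2) : |f (x + N * k)| ≤ A * y ^ (-b) := by
  refine (hf _).trans (mul_le_mul_of_nonneg_left ?_ hA)
  refine Real.rpow_le_rpow_of_nonpos hy ?_ (by linarith)
  have h1 : (1 : ℝ) ≤ |(k : ℝ)| := by exact_mod_cast Int.one_le_abs hk
  have h2 : |(N * k : ℝ)| ≤ |x + N * k| + |x| := by
    have := abs_sub (x + N * k) x
    rwa [add_sub_cancel_left] at this
  rw [abs_mul, Nat.abs_cast] at h2
  nlinarith [(Nat.cast_nonneg N : (0 : ℝ) ≤ N)]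

/-- Weights dominating the shifted copies in a periodization. -/
noncomputable def shiftWeight (b : ℝ) (k : ℤ) : ℝ :=
  (if k = 0 then 1 else 0) + 4 ^ b * |(k : ℝ)| ^ (-b)

lemma summable_shiftWeight (hb : 1 < b) : Summable (shiftWeight b) :=
  (hasSum_ite_eq (0 : ℤ) (1 : ℝ)).summable.add ((Real.summable_abs_int_rpow hb).mul_left _)

lemma abs_shift_le (hA : 0 ≤ A) (hb : 1 < b) (hf : ∀ x, |f x| ≤ A * (1 + |x|) ^ (-b)) {N : ℕ}
    (hN : 1 ≤ N) {x : ℝ} (hx : |x| ≤ N / 2) (k : ℤ) :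
    |f (x + N * k)| ≤ A * (1 + |x|) ^ (-b) * shiftWeight b k := by
  have hN1 : (1 : ℝ) ≤ N := by exact_mod_cast hN
  by_cases hk : k = 0
  · have : (0 : ℝ) ^ (-b) = 0 := Real.zero_rpow (by linarith)
    simpa [hk, shiftWeight, this] using hf x
  · have h1 : (1 : ℝ) ≤ |(k : ℝ)| := by exact_mod_cast Int.one_le_abs hk
    have h := decay_shift_le hA hb hf hx hk (y := |(k : ℝ)| * (1 + |x|) * 4⁻¹) (by positivity)
      (by nlinarith)
    refine h.trans_eq ?_
    rw [Real.mul_rpow (by positivity) (by positivity), Real.mul_rpow (by positivity) (by positivity),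
      shiftWeight, if_neg hk, Real.inv_rpow (by norm_num), Real.rpow_neg (x := 4) (by norm_num) b,
      inv_inv]
    ring

lemma abs_tsum_shift_le (hA : 0 ≤ A) (hb : 1 < b) (hf : ∀ x, |f x| ≤ A * (1 + |x|) ^ (-b)) {N : ℕ}
    (hN : 1 ≤ N) {x : ℝ} (hx : |x| ≤ N / 2) :
    |∑' k : ℤ, f (x + N * k)| ≤ A * (∑' k, shiftWeight b k) * (1 + |x|) ^ (-b) := by
  have := tsum_of_norm_bounded ((summable_shiftWeight hb).hasSum.mul_left (A * (1 + |x|) ^ (-b)))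
    (f := fun k : ℤ => f (x + N * k)) (abs_shift_le hA hb hf hN hx)
  rw [Real.norm_eq_abs] at this
  linarith

lemma tendsto_tsum_shift (hA : 0 ≤ A) (hb : 1 < b) (hf : ∀ x, |f x| ≤ A * (1 + |x|) ^ (-b))
    (x : ℝ) : Tendsto (fun N : ℕ => ∑' k : ℤ, f (x + N * k)) atTop (nhds (f x)) := by
  have hlarge : ∀ᶠ N : ℕ in atTop, 1 ≤ N ∧ |x| ≤ N / 2 := by
    filter_upwards [eventually_ge_atTop 1,
      tendsto_natCast_atTop_atTop.eventually (eventually_ge_atTop (2 * |x|))] with N h1 h2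
    exact ⟨h1, by linarith⟩
  have := tendsto_tsum_of_dominated_convergence (𝓕 := atTop)
    (f := fun (N : ℕ) (k : ℤ) => f (x + N * k)) (g := fun k : ℤ => if k = 0 then f x else 0)
    ((summable_shiftWeight hb).mul_left (A * (1 + |x|) ^ (-b))) ?_ ?_
  · rwa [tsum_ite_eq] at this
  · intro k
    by_cases hk : k = 0
    · simp [hk]
    · rw [if_neg hk]
      have hz : Tendsto (fun N : ℕ => A * ((N : ℝ) / 2) ^ (-b)) atTop (nhds 0) := by
        rw [← mul_zero A]
        refine Tendsto.const_mul A ?_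
        exact (tendsto_rpow_neg_atTop (by linarith)).comp
          (tendsto_natCast_atTop_atTop.atTop_div_const (by norm_num))
      refine squeeze_zero_norm' ?_ hz
      filter_upwards [hlarge] with N hN
      have hN1 : (1 : ℝ) ≤ N := by exact_mod_cast hN.1
      have h1 : (1 : ℝ) ≤ |(k : ℝ)| := by exact_mod_cast Int.one_le_abs hk
      exact decay_shift_le hA hb hf hN.2 hk (by positivity) (by nlinarith)
  · filter_upwards [hlarge] with N hN
    exact fun k => abs_shift_le hA hb hf hN.1 hN.2 k

end Periodization

lemma dirichletK_eq_pow (N : ℕ) (x y : ℝ) :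
    dirichletK N x y = (1 / N : ℂ) * ∑ a ∈ Finset.range N, expChar ((x - y) / N) ^ a := by
  rw [dirichletK, ← Finset.mul_sum, Fin.sum_univ_eq_sum_range (fun a : ℕ => expChar (a * (x - y) / N))]
  congr 1
  refine Finset.sum_congr rfl fun a _ => ?_
  rw [expChar, expChar, ← Complex.exp_nat_mul]
  congr 1
  push_cast
  ring

lemma expChar_half_mul_sin (t : ℝ) :
    expChar t - 1 = expChar (t / 2) * (2 * Complex.I * Real.sin (Real.pi * t)) := by
  have h : expChar t = expChar (t / 2) * expChar (t / 2) := by rw [← expChar_add, add_halves]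
  have h1 : (1 : ℂ) = expChar (t / 2) * expChar (-(t / 2)) := by
    rw [← expChar_add, add_neg_cancel, expChar_zero]
  rw [h, h1, ← mul_sub]
  congr 1
  simp only [Complex.ofReal_sin, Complex.sin, expChar]
  have e1 : ((t / 2 : ℝ) : ℂ) * (2 * Real.pi * Complex.I) = ((Real.pi * t : ℝ) : ℂ) * Complex.I := by
    push_cast; ring
  have e2 : ((-(t / 2) : ℝ) : ℂ) * (2 * Real.pi * Complex.I) =
      -((Real.pi * t : ℝ) : ℂ) * Complex.I := by push_cast; ring
  rw [e1, e2]
  linear_combination (-(Complex.exp (-((Real.pi * t : ℝ) : ℂ) * Complex.I)) +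
    Complex.exp (((Real.pi * t : ℝ) : ℂ) * Complex.I)) * Complex.I_sq

lemma tendsto_dirichletK (x y : ℝ) : Tendsto (fun N : ℕ => dirichletK N x y) atTop
    (nhds (expChar (x / 2) * (sineKernel x y : ℂ) * expChar (-(y / 2)))) := by
  by_cases hxy : x = y
  · subst hxy
    rw [sineKernel, if_pos rfl, Complex.ofReal_one, mul_one, ← expChar_add, add_neg_cancel,
      expChar_zero]
    refine tendsto_const_nhds.congr' ?_
    filter_upwards [eventually_ge_atTop 1] with N hN
    have : (N : ℂ) ≠ 0 := by exact_mod_cast (by omega : N ≠ 0)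
    rw [dirichletK_eq_pow]
    simp [expChar_zero, this]
  · set t := x - y with ht
    have ht0 : t ≠ 0 := sub_ne_zero.2 hxy
    have htc : (t * (2 * Real.pi * Complex.I) : ℂ) ≠ 0 :=
      mul_ne_zero (by exact_mod_cast ht0) Complex.two_pi_I_ne_zero
    have hd : HasDerivAt (fun s : ℝ => expChar (s * t)) (t * (2 * Real.pi * Complex.I)) 0 := by
      have h1 : HasDerivAt (fun s : ℝ => (s : ℂ) * (t * (2 * Real.pi * Complex.I)))
          (1 * (t * (2 * Real.pi * Complex.I))) 0 :=
        (hasDerivAt_id (0 : ℝ)).ofReal_comp.mul_const _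
      have h2 := h1.cexp
      simp only [Complex.ofReal_zero, zero_mul, Complex.exp_zero, one_mul] at h2
      refine h2.congr_of_eventuallyEq (Eventually.of_forall fun s => ?_)
      simp only [expChar, Complex.ofReal_mul, mul_assoc]
    have hslope := hasDerivAt_iff_tendsto_slope_zero.1 hd
    have hinv : Tendsto (fun N : ℕ => ((N : ℝ))⁻¹) atTop (nhdsWithin 0 {0}ᶜ) := by
      refine tendsto_nhdsWithin_iff.2 ⟨tendsto_inv_atTop_nhds_zero_nat, ?_⟩
      filter_upwards [eventually_ge_atTop 1] with N hN
      exact inv_ne_zero (by exact_mod_cast (by omega : N ≠ 0))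
    have hden : Tendsto (fun N : ℕ => (N : ℂ) * (expChar (t / N) - 1)) atTop
        (nhds (t * (2 * Real.pi * Complex.I))) := by
      refine (hslope.comp hinv).congr fun N => ?_
      simp only [Function.comp, inv_inv, zero_add, zero_mul, expChar_zero, Complex.real_smul,
        Complex.ofReal_natCast, inv_mul_eq_div]
    have hlim : (expChar t - 1) / (t * (2 * Real.pi * Complex.I)) =
        expChar (x / 2) * (sineKernel x y : ℂ) * expChar (-(y / 2)) := by
      have hh : expChar (t / 2) = expChar (x / 2) * expChar (-(y / 2)) := by
        rw [← expChar_add]; congr 1; rw [ht]; ring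
      rw [expChar_half_mul_sin, hh, sineKernel, if_neg hxy, ← ht]
      have h1 : (t : ℂ) ≠ 0 := by exact_mod_cast ht0
      have h2 : (Real.pi : ℂ) ≠ 0 := by exact_mod_cast Real.pi_ne_zero
      have := Complex.I_ne_zero
      push_cast
      field_simp
    rw [← hlim]
    refine ((tendsto_const_nhds (x := expChar t - 1)).div hden htc).congr' ?_
    filter_upwards [hden.eventually_ne htc, eventually_ge_atTop 1] with N hne hN
    have hN0 : (N : ℂ) ≠ 0 := by exact_mod_cast (by omega : N ≠ 0)
    have hN0' : (N : ℝ) ≠ 0 := by exact_mod_cast (by omega : N ≠ 0)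
    have hq : expChar (t / N) ≠ 1 := fun h => hne (by rw [h, sub_self, mul_zero])
    have hpow : expChar (t / N) ^ N = expChar t := by
      rw [expChar, expChar, ← Complex.exp_nat_mul]
      congr 1; push_cast; field_simp
    rw [dirichletK_eq_pow, ← ht, geom_sum_eq hq, hpow]
    have := sub_ne_zero.2 hq
    simp only [Pi.div_apply]
    field_simp

/-- The rescaled correlation functions converge to the sine-kernel determinants. -/
theorem tendsto_dirichletDet {r : ℕ} (x : Fin r → ℝ) : Tendsto (fun N : ℕ => dirichletDet N x) atTop
    (nhds (sineCorrelation r x : ℂ)) := by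
  have hdet : (sineCorrelation r x : ℂ) = (Matrix.of fun i k : Fin r =>
      expChar (x i / 2) * (sineKernel (x i) (x k) : ℂ) * expChar (-(x k / 2))).det := by
    rw [Matrix.det_apply', sineCorrelation, Matrix.det_apply', Complex.ofReal_sum]
    refine Finset.sum_congr rfl fun ρ _ => ?_
    simp only [Matrix.of_apply, Finset.prod_mul_distrib]
    rw [Equiv.prod_comp ρ fun i => expChar (x i / 2), mul_right_comm, ← Finset.prod_mul_distrib]
    simp [← expChar_add, expChar_zero]
  rw [hdet]
  unfold dirichletDet
  simp only [Matrix.det_apply', Matrix.of_apply]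
  exact tendsto_finsetSum _ fun ρ _ => tendsto_const_nhds.mul
    (tendsto_finsetProd _ fun i _ => tendsto_dirichletK _ _)

section Limit

open CanonicalSurjection

variable {m r : ℕ} {f : ℝ → ℝ} {A b : ℝ}

/-- The linear statistic of the rescaled periodic eigenvalue process against which moments are
integrated. -/
noncomputable def momentIntegrand (f : ℝ → ℝ) (σ : Fin m → Fin r) (N : ℕ) (x : Fin r → ℝ) : ℂ :=
  (∏ i, ((∑' k : ℤ, f (x (σ i) + N * k) : ℝ) : ℂ)) * dirichletDet N x

lemma abs_le_of_mem_period {N : ℕ} {x : ℝ} (hx : x ∈ period N) : |x| ≤ N / 2 :=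
  abs_le.2 ⟨hx.1.le, hx.2⟩

lemma eventually_mem_box (x : Fin r → ℝ) :
    ∀ᶠ N : ℕ in atTop, x ∈ Set.univ.pi fun _ : Fin r => period N := by
  have (i : Fin r) : ∀ᶠ N : ℕ in atTop, x i ∈ period N := by
    filter_upwards [tendsto_natCast_atTop_atTop.eventually (eventually_gt_atTop (2 * |x i|))] with N hN
    have := abs_lt.1 (by linarith : |x i| < (N : ℝ) / 2)
    exact ⟨this.1, this.2.le⟩
  filter_upwards [eventually_all.2 this] with N hN
  exact fun i _ => hN i

lemma boxMeasure_eq (N r : ℕ) : boxMeasure N r =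
    (volume : Measure (Fin r → ℝ)).restrict (Set.univ.pi fun _ => period N) := by
  rw [boxMeasure, volume_pi, Measure.restrict_pi_pi]

lemma measurableSet_box (N r : ℕ) : MeasurableSet (Set.univ.pi fun _ : Fin r => period N) :=
  MeasurableSet.univ_pi fun _ => measurableSet_Ioc

lemma prod_comp_le {σ : Fin m → Fin r} (hσ : Function.Surjective σ) {p : Fin r → ℝ}
    (h0 : ∀ k, 0 ≤ p k) (h1 : ∀ k, p k ≤ 1) : ∏ i, p (σ i) ≤ ∏ k, p k := by
  rw [← Finset.prod_fiberwise (Finset.univ : Finset (Fin m)) σ]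
  refine Finset.prod_le_prod (fun k _ => Finset.prod_nonneg fun i _ => h0 _) fun k _ => ?_
  obtain ⟨i, hi⟩ := hσ k
  have hcard : (Finset.univ.filter fun i => σ i = k).card ≠ 0 :=
    Finset.card_ne_zero_of_mem (Finset.mem_filter.2 ⟨Finset.mem_univ i, hi⟩)
  rw [Finset.prod_congr rfl fun i hi => by rw [(Finset.mem_filter.1 hi).2], Finset.prod_const]
  exact pow_le_of_le_one (h0 k) (h1 k) hcard

theorem tendsto_integral_momentIntegrand {σ : Fin m → Fin r} (hσ : Function.Surjective σ)
    (hA : 0 ≤ A) (hb : 1 < b) (hf : ∀ x, |f x| ≤ A * (1 + |x|) ^ (-b))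
    (hmeas : ∀ N : ℕ, 1 ≤ N → Continuous (fun x => ∑' k : ℤ, f (x + N * k))) :
    Tendsto (fun N : ℕ => ∫ x, momentIntegrand f σ N x ∂boxMeasure N r) atTop
      (nhds ((∫ x : Fin r → ℝ, sineCorrelation r x *
        ∏ k : Fin r, f (x k) ^ (Finset.univ.filter (fun j => σ j = k)).card : ℝ) : ℂ)) := by
  simp only [boxMeasure_eq, ← integral_indicator (measurableSet_box _ r)]
  rw [← integral_complex_ofReal]
  set C := A * ∑' k, shiftWeight b k with hC
  have hC0 : 0 ≤ C := by
    refine mul_nonneg hA (tsum_nonneg fun k => ?_)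
    unfold shiftWeight
    positivity
  have hp0 (x : ℝ) : 0 ≤ (1 + |x|) ^ (-b) := by positivity
  have hp1 (x : ℝ) : (1 + |x|) ^ (-b) ≤ 1 :=
    Real.rpow_le_one_of_one_le_of_nonpos (by linarith [abs_nonneg x]) (by linarith)
  refine tendsto_integral_filter_of_dominated_convergence
    (fun x => C ^ m * r.factorial * ∏ k, (1 + |x k|) ^ (-b)) ?_ ?_ ?_ ?_
  · filter_upwards [eventually_ge_atTop 1] with N hN
    refine Continuous.aestronglyMeasurable ?_ |>.indicator (measurableSet_box _ r)
    have := hmeas N hN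
    have := continuous_dirichletDet N r
    change Continuous fun x => momentIntegrand f σ N x
    unfold momentIntegrand
    refine Continuous.mul (continuous_finsetProd _ fun i _ => Complex.continuous_ofReal.comp ?_) this
    exact (hmeas N hN).comp (continuous_apply (σ i))
  · filter_upwards [eventually_ge_atTop 1] with N hN
    refine Eventually.of_forall fun x => ?_
    by_cases hx : x ∈ Set.univ.pi fun _ : Fin r => period N
    · rw [Set.indicator_of_mem hx, momentIntegrand, norm_mul, norm_prod]
      have h1 : ∏ i, ‖((∑' k : ℤ, f (x (σ i) + N * k) : ℝ) : ℂ)‖ ≤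
          C ^ m * ∏ k, (1 + |x k|) ^ (-b) := by
        calc ∏ i, ‖((∑' k : ℤ, f (x (σ i) + N * k) : ℝ) : ℂ)‖
            ≤ ∏ i, (C * (1 + |x (σ i)|) ^ (-b)) := by
              refine Finset.prod_le_prod (fun _ _ => norm_nonneg _) fun i _ => ?_
              rw [Complex.norm_real, Real.norm_eq_abs]
              exact abs_tsum_shift_le hA hb hf hN (abs_le_of_mem_period (hx (σ i) trivial))
          _ = C ^ m * ∏ i, (1 + |x (σ i)|) ^ (-b) := by
              rw [Finset.prod_mul_distrib, Finset.prod_const, Finset.card_univ, Fintype.card_fin]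
          _ ≤ _ := mul_le_mul_of_nonneg_left
              (prod_comp_le hσ (p := fun k => (1 + |x k|) ^ (-b)) (fun k => hp0 _) fun k => hp1 _)
              (pow_nonneg hC0 m)
      calc _ ≤ (C ^ m * ∏ k, (1 + |x k|) ^ (-b)) * r.factorial :=
            mul_le_mul h1 (norm_dirichletDet_le N x) (norm_nonneg _)
              (mul_nonneg (pow_nonneg hC0 m) (Finset.prod_nonneg fun k _ => hp0 _))
        _ = _ := by ring
    · rw [Set.indicator_of_notMem hx, norm_zero]
      exact mul_nonneg (mul_nonneg (pow_nonneg hC0 m) (Nat.cast_nonneg _))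
        (Finset.prod_nonneg fun k _ => hp0 _)
  · refine Integrable.const_mul ?_ _
    refine Integrable.fintype_prod (f := fun (_ : Fin r) (x : ℝ) => (1 + |x|) ^ (-b)) fun _ => ?_
    exact integrable_one_add_norm (E := ℝ) (by simpa using hb)
  · refine Eventually.of_forall fun x => ?_
    have hlim : Tendsto (fun N => momentIntegrand f σ N x) atTop
        (nhds ((∏ i, (f (x (σ i)) : ℂ)) * (sineCorrelation r x : ℂ))) := by
      refine Tendsto.mul (tendsto_finsetProd _ fun i _ => ?_) (tendsto_dirichletDet x)
      exact (Complex.continuous_ofReal.tendsto _).comp (tendsto_tsum_shift hA hb hf _)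
    have hval : (∏ i, (f (x (σ i)) : ℂ)) * (sineCorrelation r x : ℂ) = ((sineCorrelation r x *
        ∏ k : Fin r, f (x k) ^ (Finset.univ.filter (fun j => σ j = k)).card : ℝ) : ℂ) := by
      rw [mul_comm, Complex.ofReal_mul, ← Complex.ofReal_prod,
        ← Finset.prod_fiberwise (Finset.univ : Finset (Fin m)) σ]
      congr 2
      refine Finset.prod_congr rfl fun k _ => ?_
      rw [Finset.prod_congr rfl fun i hi => by rw [(Finset.mem_filter.1 hi).2], Finset.prod_const]
    rw [← hval]
    refine hlim.congr' ?_
    filter_upwards [eventually_mem_box x] with N hN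
    rw [Set.indicator_of_mem hN]

end Limit

open scoped Classical in
/-- Unrestricted moments of `Z_f`: for `f` even, continuous, with both `f` and `f̂` decaying
polynomially, `lim_{N→∞} ∫_{U(N)} Z_f(U)^m dμ_N = ∑_{r=1}^m ∑_{σ ∈ P(m,r)}
∫_{ℝ^r} R_r(x₁,…,x_r) ∏ₖ f(xₖ)^{λₖ} dx`, where `λₖ = #{j : σ(j) = k}` and `P(m,r)` is the
set of canonical surjections `{1,…,m} → {1,…,r}`. -/
theorem moments_Zf_unrestricted (m : ℕ) (hm : 1 ≤ m)
    (μ : ∀ N : ℕ, Measure (Matrix.unitaryGroup (Fin N) ℂ))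
    (hprob : ∀ N, IsProbabilityMeasure (μ N))
    (hinv : ∀ N, (μ N).IsMulLeftInvariant)
    (f fhat : ℝ → ℝ) (heven : ∀ x, f (-x) = f x) (hfcont : Continuous f)
    (hcont : Continuous fhat)
    (hdecay : ∃ A ε : ℝ, 0 < A ∧ 0 < ε ∧
      (∀ x : ℝ, |f x| ≤ A * (1 + |x|) ^ (-(1 + ε))) ∧
      (∀ u : ℝ, |fhat u| ≤ A * (1 + |u|) ^ (-(1 + ε))))
    (hfourier : ∀ u : ℝ, (fhat u : ℂ) =
      ∫ x : ℝ, (f x : ℂ) * Complex.exp (-(2 * Real.pi * Complex.I) * x * u)) :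
    Tendsto (fun N : ℕ => ∫ U, (Zf N fhat U) ^ m ∂(μ N))
      atTop
      (nhds ((∑ r ∈ Finset.Icc 1 m,
        ∑ σ ∈ Finset.univ.filter (fun σ : Fin m → Fin r =>
          Function.Surjective σ ∧
            ∀ j, (σ j : ℕ) = 0 ∨ ∃ k, k < j ∧ (σ j : ℕ) = (σ k : ℕ) + 1),
          ∫ x : Fin r → ℝ, sineCorrelation r x *
            ∏ k : Fin r, f (x k) ^ (Finset.univ.filter (fun j => σ j = k)).card : ℝ) : ℂ)) := by
  obtain ⟨A, ε, hA, hε, hf, hfhat⟩ := hdecay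
  have hb : 1 < 1 + ε := by linarith
  have hpoisson {N : ℕ} (hN : 1 ≤ N) (x : ℝ) := tsum_expChar_eq_tsum hN hfcont hA.le hb hf hfhat
    hfourier x
  have hmeas (N : ℕ) (hN : 1 ≤ N) : Continuous fun x => ∑' k : ℤ, f (x + N * k) := by
    have h : Continuous fun x : ℝ => ∑' n : ℤ,
        (1 / N : ℂ) * (fhat ((n : ℝ) / N) : ℂ) * expChar (x * n / N) := by
      refine continuous_tsum (fun n => ?_) (summable_fhat hN hA.le hb hfhat) fun n x => ?_
      · have := continuous_expChar
        fun_prop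
      · rw [norm_mul, norm_expChar, mul_one]
    simp only [hpoisson hN] at h
    exact (Complex.continuous_re.comp h).congr fun x => Complex.ofReal_re _
  have hmoment : ∀ᶠ N : ℕ in atTop, (∑ r ∈ Finset.range (m + 1),
      ∑ σ ∈ Finset.univ.filter (CanonicalSurjection.IsCanonical (m := m) (r := r)),
        ∫ x, momentIntegrand f σ N x ∂boxMeasure N r) = ∫ U, (Zf N fhat U) ^ m ∂(μ N) := by
    filter_upwards [eventually_ge_atTop 1] with N hN
    have := hprob N
    have := hinv N
    have h := UnitaryMoments.integral_tsum_pow (m := m) hN (μ N)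
      (fun n : ℤ => (1 / N : ℂ) * (fhat ((n : ℝ) / N) : ℂ)) (summable_fhat hN hA.le hb hfhat)
    simp only [hpoisson hN] at h
    exact h.symm
  refine Tendsto.congr' hmoment ?_
  have hrange (N : ℕ) : (∑ r ∈ Finset.Icc 1 m,
      ∑ σ ∈ Finset.univ.filter (CanonicalSurjection.IsCanonical (m := m) (r := r)),
        ∫ x, momentIntegrand f σ N x ∂boxMeasure N r) = ∑ r ∈ Finset.range (m + 1),
      ∑ σ ∈ Finset.univ.filter (CanonicalSurjection.IsCanonical (m := m) (r := r)),
        ∫ x, momentIntegrand f σ N x ∂boxMeasure N r := by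
    refine Finset.sum_subset (fun r hr => ?_) fun r hr hr' => ?_
    · rw [Finset.mem_range]
      exact Nat.lt_succ_of_le (Finset.mem_Icc.1 hr).2
    · obtain rfl : r = 0 := by
        rw [Finset.mem_range] at hr
        rw [Finset.mem_Icc] at hr'
        omega
      exact Finset.sum_eq_zero fun σ _ => (σ ⟨0, hm⟩).elim0
  simp only [← hrange]
  rw [Complex.ofReal_sum]
  refine tendsto_finsetSum _ fun r _ => ?_
  have hfilter : Finset.univ.filter (fun σ : Fin m → Fin r => Function.Surjective σ ∧
      ∀ j, (σ j : ℕ) = 0 ∨ ∃ k, k < j ∧ (σ j : ℕ) = (σ k : ℕ) + 1) =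
      Finset.univ.filter (CanonicalSurjection.IsCanonical (m := m) (r := r)) := by
    ext σ
    rw [Finset.mem_filter, Finset.mem_filter, CanonicalSurjection.IsCanonical]
  rw [hfilter, Complex.ofReal_sum]
  refine tendsto_finsetSum _ fun σ hσ => ?_
  exact tendsto_integral_momentIntegrand (Finset.mem_filter.1 hσ).2.1 hA.le hb hf hmeas
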